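/- The braid group B₄ has the ℓ² spectral radius property: for every finitely supported function a : B₄ → ℂ, if L_a : ℓ²(B₄) → ℓ²(B₄) is the bounded operator of left convolution by a (characterized by (L_a ξ)(g) = Σ_h a(h)·ξ(h⁻¹g) for all ξ ∈ ℓ²(B₄) and g ∈ B₄), then the spectral radius of L_a equals lim_{n→∞} ‖a^{*n}‖₂^{1/n}, where a^{*n} denotes the n-fold convolution power of a and ‖·‖₂ the ℓ² norm of a finitely supported function. -/

import Mathlib

/-- Convolution of finitely supported complex functions on a group:
`(f * g)(x) = ∑_y f(y) g(y⁻¹x)`. -/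
noncomputable def conv {Γ : Type*} [Group Γ] (f g : Γ →₀ ℂ) : Γ →₀ ℂ :=
  f.sum fun y cy => g.sum fun z cz => Finsupp.single (y * z) (cy * cz)

/-- The ℓ² norm of a finitely supported complex function. -/
noncomputable def l2norm {Γ : Type*} (f : Γ →₀ ℂ) : ℝ :=
  Real.sqrt (f.sum fun _ c => ‖c‖ ^ 2)

/-- Property RD of a group with respect to a length function `ℓ`. -/
def HasPropertyRD (Γ : Type*) [Group Γ] (ℓ : Γ → ℝ) : Prop :=
  ∃ P : Polynomial ℝ, ∀ r : ℝ, 0 ≤ r → ∀ f g : Γ →₀ ℂ,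
    (∀ x : Γ, f x ≠ 0 → ℓ x ≤ r) →
    l2norm (conv f g) ≤ P.eval r * l2norm f * l2norm g

/-- The word length with respect to a generating set `S` (using `S ∪ S⁻¹`). -/
noncomputable def wordLength {Γ : Type*} [Group Γ] (S : Set Γ) (x : Γ) : ℕ :=
  sInf {n : ℕ | ∃ w : List Γ, w.length = n ∧ (∀ s ∈ w, s ∈ S ∨ s⁻¹ ∈ S) ∧ w.prod = x}

/-- The braid relations of `B₄ = ⟨a,b,c ∣ aba=bab, bcb=cbc, ac=ca⟩`. -/
def braidRels4 : Set (FreeGroup (Fin 3)) :=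
  { FreeGroup.of 0 * FreeGroup.of 1 * FreeGroup.of 0 *
      (FreeGroup.of 1 * FreeGroup.of 0 * FreeGroup.of 1)⁻¹,
    FreeGroup.of 1 * FreeGroup.of 2 * FreeGroup.of 1 *
      (FreeGroup.of 2 * FreeGroup.of 1 * FreeGroup.of 2)⁻¹,
    FreeGroup.of 0 * FreeGroup.of 2 * (FreeGroup.of 2 * FreeGroup.of 0)⁻¹ }

/-- The braid group on 4 strings. -/
abbrev B4 : Type := PresentedGroup braidRels4

def a : B4 := PresentedGroup.of 0
def b : B4 := PresentedGroup.of 1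
def c : B4 := PresentedGroup.of 2

open scoped ENNReal

/-- Convolution powers: `convPow f n = f^{*n}` is the `n`-fold convolution power. -/
noncomputable def convPow {Γ : Type*} [Group Γ] (f : Γ →₀ ℂ) : ℕ → (Γ →₀ ℂ)
  | 0 => Finsupp.single 1 1
  | n + 1 => conv (convPow f n) f

/-- An integer-valued asymmetric metric `ι` (negative values allowed) with a height function of
rank three and the Riesz interpolation property. The model is a group with a left-invariant order
having interpolation, with `ι x y = min {k | x ≤ y δ ^ k}` for a Garside element `δ`
of height three. -/
structure RankThree (X : Type*) where
  /-- the asymmetric metric -/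
  ι : X → X → ℤ
  /-- the height -/
  ht : X → ℤ
  ι_self : ∀ x, ι x x = 0
  ι_tri : ∀ x y z, ι x z ≤ ι x y + ι y z
  ht_le : ∀ x y, ht x ≤ ht y + 3 * ι x y
  ht_eq : ∀ x y, ht x = ht y + 3 * ι x y → ι x y + ι y x = 0
  interp : ∀ (x₁ x₂ y₁ y₂ : X) (s₁ s₂ t₁ t₂ : ℤ),
    ι x₁ y₁ ≤ s₁ + t₁ → ι x₁ y₂ ≤ s₁ + t₂ → ι x₂ y₁ ≤ s₂ + t₁ → ι x₂ y₂ ≤ s₂ + t₂ →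
    ∃ z, ι x₁ z ≤ s₁ ∧ ι x₂ z ≤ s₂ ∧ ι z y₁ ≤ t₁ ∧ ι z y₂ ≤ t₂

namespace RankThree

variable {X : Type*} (R : RankThree X)

/-- The symmetrized metric. -/
def d (x y : X) : ℤ := R.ι x y + R.ι y x

lemma d_self (x : X) : R.d x x = 0 := by simp [d, R.ι_self]

lemma d_comm (x y : X) : R.d x y = R.d y x := by simp [d, add_comm]

lemma d_tri (x y z : X) : R.d x z ≤ R.d x y + R.d y z := by
  have := R.ι_tri x y z
  have := R.ι_tri z y x
  simp only [d]
  omega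

lemma d_nonneg (x y : X) : 0 ≤ R.d x y := by
  have := R.ι_tri x y x
  rw [R.ι_self] at this
  exact this

lemma ht_eq_of_d_eq_zero {x y : X} (h : R.d x y = 0) : R.ht x = R.ht y + 3 * R.ι x y := by
  have := R.ht_le x y
  have := R.ht_le y x
  simp only [d] at h
  omega

lemma ht_lt {x y : X} (h : R.d x y ≠ 0) : R.ht x < R.ht y + 3 * R.ι x y :=
  lt_of_le_of_ne (R.ht_le x y) fun e => h (R.ht_eq x y e)

lemma d_congr_right {x y z : X} (h : R.d y z = 0) : R.d x y = R.d x z := by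
  have := R.d_tri x y z
  have := R.d_tri x z y
  have := R.d_comm y z
  omega

lemma d_congr_left {x y z : X} (h : R.d y z = 0) : R.d y x = R.d z x := by
  rw [R.d_comm y, R.d_comm z, R.d_congr_right h]

lemma exists_first_step {x y : X} (h : R.d x y ≠ 0) :
    ∃ v, R.ι x v ≤ 0 ∧ R.ι v x ≤ 1 ∧ R.ι v y ≤ R.ι x y ∧
      R.d x v = 1 ∧ R.d v y = R.d x y - 1 := by
  have h0 := R.d_nonneg x y
  obtain ⟨v, h1, h2, h3, h4⟩ := R.interp x y x y 0 (R.ι y x - 1) 1 (R.ι x y)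
    (by rw [R.ι_self]; omega) (by omega) (by omega)
    (by rw [R.ι_self]; simp only [d] at *; omega)
  have := R.d_tri x v y
  have := R.d_comm v y
  simp only [d] at *
  exact ⟨v, h1, h3, h4, by omega, by omega⟩

lemma triangle_condition {u v w : X} (huv : R.d u v = 1) (hw : R.d w u = R.d w v)
    (h0 : R.d w u ≠ 0) :
    ∃ z, R.d u z = 1 ∧ R.d v z = 1 ∧ R.d w z = R.d w u - 1 := by
  have key : ∀ u v : X, R.d u v = 1 → R.d w u = R.d w v → R.d w u ≠ 0 →
      R.ι w v = R.ι w u + R.ι u v →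
      ∃ z, R.d u z = 1 ∧ R.d v z = 1 ∧ R.d w z = R.d w u - 1 := by
    intro u v huv hw h0 hA
    have hn := R.d_nonneg w u
    obtain ⟨z, h1, h2, h3, h4⟩ := R.interp w v u w (R.ι w u) (R.ι v u) 0 (R.ι u w - 1)
      (by omega) (by rw [R.ι_self]; simp only [d] at *; omega) (by omega)
      (by simp only [d] at *; omega)
    have := R.d_tri w z u
    have := R.d_tri w z v
    have := R.d_comm z u
    have := R.d_comm z v
    have := R.ι_tri u v z
    have := R.ι_tri z u v
    simp only [d] at *
    exact ⟨z, by omega, by omega, by omega⟩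
  have := R.ι_tri w u v
  have := R.ι_tri w v u
  have := R.ι_tri u v w
  have := R.ι_tri v u w
  by_cases hA : R.ι w v = R.ι w u + R.ι u v
  · exact key u v huv hw h0 hA
  · obtain ⟨z, h1, h2, h3⟩ := key v u (by rw [R.d_comm, huv]) hw.symm (hw ▸ h0)
      (by simp only [d] at *; omega)
    exact ⟨z, h2, h1, by rw [h3, hw]⟩

lemma no_equidistant_triangle {u v t w : X} (huv : R.d u v = 1) (hvt : R.d v t = 1)
    (htu : R.d t u = 1) (hv : R.d w v = R.d w u) (ht : R.d w t = R.d w u) : False := by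
  have key : ∀ x₁ x₂ x₃ : X, R.d x₁ x₂ = 1 → R.d x₂ x₃ = 1 → R.d x₃ x₁ = 1 →
      R.d w x₂ = R.d w x₁ → R.d w x₃ = R.d w x₁ → R.ι x₁ x₂ + R.ι x₂ x₃ + R.ι x₃ x₁ = 1 →
      R.ι w x₁ - R.ι w x₃ = R.ι x₃ x₁ - 1 → False := by
    intro x₁ x₂ x₃ h12 h23 h31 h2 h3 hs hA
    have hk : R.d w x₁ ≠ 0 := by
      intro h
      have := R.d_tri x₁ w x₂
      have := R.d_comm w x₁
      omega
    have hk' := R.d_nonneg w x₁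
    obtain ⟨z, g1, g2, g3, g4⟩ := R.interp w x₃ x₁ w (R.ι w x₁) (R.ι x₃ x₁) 0 (R.ι x₁ w - 1)
      (by omega) (by rw [R.ι_self]; simp only [d] at *; omega) (by omega)
      (by simp only [d] at *; omega)
    have hz1 : R.d z x₁ ≠ 0 := by
      intro h
      have := R.d_congr_right (x := w) h
      simp only [d] at *
      omega
    have hz3 : R.d x₃ z ≠ 0 := by
      intro h
      have := R.d_congr_right (x := w) h
      simp only [d] at *
      omega
    have := R.ht_lt hz1
    have := R.ht_lt hz3
    have := R.ht_lt (x := x₁) (y := x₂) (by omega)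
    have := R.ht_lt (x := x₂) (y := x₃) (by omega)
    omega
  have oriented : ∀ x₁ x₂ x₃ : X, R.d x₁ x₂ = 1 → R.d x₂ x₃ = 1 → R.d x₃ x₁ = 1 →
      R.d w x₂ = R.d w x₁ → R.d w x₃ = R.d w x₁ → R.ι x₁ x₂ + R.ι x₂ x₃ + R.ι x₃ x₁ = 1 →
      False := by
    intro x₁ x₂ x₃ h12 h23 h31 h2 h3 hs
    have a1 := R.ι_tri w x₁ x₂
    have a2 := R.ι_tri w x₂ x₃
    have a3 := R.ι_tri w x₃ x₁
    have b1 := R.ι_tri w x₂ x₁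
    have b2 := R.ι_tri w x₃ x₂
    have b3 := R.ι_tri w x₁ x₃
    by_cases c3 : R.ι w x₁ - R.ι w x₃ = R.ι x₃ x₁ - 1
    · exact key x₁ x₂ x₃ h12 h23 h31 h2 h3 hs c3
    by_cases c1 : R.ι w x₂ - R.ι w x₁ = R.ι x₁ x₂ - 1
    · exact key x₂ x₃ x₁ h23 h31 h12 (by omega) (by omega) (by omega) c1
    by_cases c2 : R.ι w x₃ - R.ι w x₂ = R.ι x₂ x₃ - 1
    · exact key x₃ x₁ x₂ h31 h12 h23 (by omega) (by omega) (by omega) c2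
    simp only [d] at *
    omega
  have := R.ht_lt (x := u) (y := v) (by omega)
  have := R.ht_lt (x := v) (y := t) (by omega)
  have := R.ht_lt (x := t) (y := u) (by omega)
  have := R.ht_lt (x := v) (y := u) (by rw [R.d_comm]; omega)
  have := R.ht_lt (x := t) (y := v) (by rw [R.d_comm]; omega)
  have := R.ht_lt (x := u) (y := t) (by rw [R.d_comm]; omega)
  by_cases hs : R.ι u v + R.ι v t + R.ι t u = 1
  · exact oriented u v t huv hvt htu hv ht hs
  · refine oriented u t v (by rw [R.d_comm, htu]) (by rw [R.d_comm, hvt])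
      (by rw [R.d_comm, huv]) ht hv ?_
    simp only [d] at *
    omega

lemma predecessors_clique {u v s w : X} (hsu : R.d s u = 1) (hsv : R.d s v = 1)
    (hu : R.d w u = R.d w s - 1) (hv : R.d w v = R.d w s - 1) : R.d u v ≤ 1 := by
  have t1 := R.ι_tri w u s
  have t2 := R.ι_tri s u w
  have t3 := R.ι_tri w v s
  have t4 := R.ι_tri s v w
  have t5 := R.ι_tri u s v
  have t6 := R.ι_tri v s u
  obtain ⟨z', a1, a2, a3, a4⟩ := R.interp s w u v 0 (R.ι w s - 1) (R.ι s u) (R.ι s v)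
    (by omega) (by omega) (by simp only [d] at *; omega) (by simp only [d] at *; omega)
  obtain ⟨z, b1, b2, b3, b4⟩ := R.interp u v s w (R.ι u s) (R.ι v s) 0 (R.ι s w - 1)
    (by omega) (by simp only [d] at *; omega) (by omega) (by simp only [d] at *; omega)
  have hz' : R.d s z' ≠ 0 := by
    intro h
    have := R.ι_tri w z' s
    have := R.ι_tri s z' w
    have := R.ι_tri z' u w
    simp only [d] at *
    omega
  have hz : R.d z s ≠ 0 := by
    intro h
    have := R.ι_tri s z w
    have := R.ι_tri w z s
    have := R.ι_tri w u z
    simp only [d] at *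
    omega
  have e1 := R.ht_lt hz'
  have e2 := R.ht_lt hz
  have f1 := R.ht_le z' u
  have f2 := R.ht_le u z
  by_cases g1 : R.d z' u = 0
  · have := R.ι_tri u z' v
    simp only [d] at *
    omega
  by_cases g2 : R.d u z = 0
  · have := R.ι_tri v z u
    simp only [d] at *
    omega
  have := R.ht_lt g1
  have := R.ht_lt g2
  simp only [d] at *
  omega

/-- Points of the metric interval between `x` and `y`. -/
def Btw (x v y : X) : Prop := R.d x v + R.d v y = R.d x y

lemma Btw.symm {x v y : X} (h : R.Btw x v y) : R.Btw y v x := by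
  simp only [Btw, R.d_comm y, R.d_comm v x] at *
  omega

lemma Btw.trans_right {x v w y : X} (h : R.Btw x v y) (h' : R.Btw v w y) : R.Btw x w y := by
  simp only [Btw] at *
  have := R.d_tri x v w
  have := R.d_tri x w y
  omega

lemma Btw.trans_left {x v w y : X} (h : R.Btw x v y) (h' : R.Btw x w v) : R.Btw x w y :=
  ((h.symm).trans_right R h'.symm).symm

lemma btw_rigid {x y u v : X} (hu : R.Btw x u y) (hv : R.Btw x v y) (hd : R.d x u = R.d x v)
    (hι : R.ι x u = R.ι x v) (hh : R.ht u = R.ht v) : R.d u v = 0 := by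
  have t1 := R.ι_tri x u y
  have t2 := R.ι_tri y u x
  have t3 := R.ι_tri x v y
  have t4 := R.ι_tri y v x
  let P : ℤ → Prop := fun n => ∃ z, R.ht z = n ∧ R.ι x z ≤ R.ι x u ∧ R.ι y z ≤ R.ι y u ∧
    R.ι z u ≤ 0 ∧ R.ι z v ≤ 0
  obtain ⟨n, ⟨z, rfl, z1, z2, z3, z4⟩, hmax⟩ : ∃ n, P n ∧ ∀ m, P m → m ≤ n := by
    refine Int.exists_greatest_of_bdd ⟨R.ht u, ?_⟩ ?_
    · rintro m ⟨z, rfl, -, -, h, -⟩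
      have := R.ht_le z u
      omega
    · obtain ⟨z, h1, h2, h3, h4⟩ := R.interp x y u v (R.ι x u) (R.ι y u) 0 0 (by omega) (by omega)
        (by omega) (by simp only [Btw, d] at *; omega)
      exact ⟨_, z, rfl, h1, h2, h3, h4⟩
  have s1 := R.ι_tri x z y
  have s2 := R.ι_tri y z x
  have s3 := R.ι_tri z u x
  have s4 := R.ι_tri z u y
  have s5 := R.ι_tri x z u
  have s6 := R.ι_tri x z v
  by_cases gu : R.d z u = 0
  · have := R.ht_eq_of_d_eq_zero gu
    have gv := R.ht_eq z v (by simp only [Btw, d] at *; omega)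
    rw [← R.d_congr_left gu]
    exact gv
  by_cases gv : R.d z v = 0
  · have := R.ht_eq_of_d_eq_zero gv
    have gu := R.ht_eq z u (by simp only [Btw, d] at *; omega)
    rw [← R.d_congr_left gu]
    exact gv
  obtain ⟨u', a1, a2, a3, a4, -⟩ := R.exists_first_step gu
  obtain ⟨v', b1, b2, b3, b4, -⟩ := R.exists_first_step gv
  obtain ⟨z', c1, c2, c3, c4⟩ := R.interp u v x y 0 0 (R.ι u x) (R.ι u y) (by omega) (by omega)
    (by simp only [Btw, d] at *; omega) (by simp only [Btw, d] at *; omega)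
  have r1 := R.ι_tri u' u z'
  have r2 := R.ι_tri v' v z'
  obtain ⟨w, e1, e2, e3, e4⟩ := R.interp u' v' z' z 0 0 0 1 (by omega) (by omega) (by omega)
    (by omega)
  have side : ∀ p, R.ι z p ≤ 0 → R.ι p z ≤ 1 → R.d z p = 1 → R.ι p w ≤ 0 → R.ι p z' ≤ 0 →
      R.d p w = 0 := by
    intro p p1 p2 p3 p4 p5
    by_contra hpw
    have hz := R.ht_lt (x := z) (y := p) (by omega)
    have hp := R.ht_lt hpw
    have q1 := R.ι_tri z p w
    have q2 := R.ι_tri w z p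
    have q3 := R.ι_tri x z w
    have q4 := R.ι_tri w z' x
    have q5 := R.ι_tri w z' y
    have q6 := R.ι_tri y z w
    have q7 := R.ι_tri x w y
    have q8 := R.ι_tri y w x
    have q9 := R.ι_tri x z p
    have q10 := R.ι_tri p z' x
    have q11 := R.ι_tri p z' y
    have q12 := R.ι_tri y z p
    have q13 := R.ι_tri x p y
    have q14 := R.ι_tri y p x
    have hn := R.d_nonneg p w
    have hwz : R.d w z ≠ 0 := by
      intro h
      have := R.ht_eq_of_d_eq_zero h
      have := R.ι_tri x w z
      simp only [Btw, d] at *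
      omega
    have hn' := R.d_nonneg w z
    refine R.no_equidistant_triangle (u := z) (v := p) (t := w) (w := x) p3 ?_ ?_ ?_ ?_
    all_goals simp only [Btw, d] at *; omega
  have hu' := side u' a1 a2 a4 e1 (by omega)
  have hv' := side v' b1 b2 b4 e2 (by omega)
  have := R.ht_lt (x := z) (y := u') (by omega)
  have k1 := R.ι_tri u' w v'
  have k2 := R.ι_tri u' v' v
  have k3 := R.ι_tri x z u'
  have k4 := R.ι_tri y z u'
  have k5 := R.ι_tri x z v'
  have k6 := R.ι_tri x w v'
  have k7 := R.ι_tri v' z' x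
  have k8 := R.ι_tri v' z' y
  have k9 := R.ι_tri y z v'
  have k10 := R.ι_tri x v' y
  have k11 := R.ι_tri y v' x
  have k12 := R.ι_tri x z w
  have m1 := R.ι_tri w z' y
  have m2 := R.ι_tri x w y
  have m3 := R.ι_tri x v' w
  have := hmax (R.ht u') ⟨u', rfl, by omega, by omega, by omega, by
    simp only [Btw, d] at *; omega⟩
  have l1 := R.ι_tri x u' y
  have l2 := R.ι_tri y u' x
  simp only [Btw, d] at *
  omega

end RankThree

namespace RankThree

variable {X : Type*} (R : RankThree X)

lemma exists_step_descending {p q r : X} (h : R.d p r < R.d p q) :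
    ∃ z, R.Btw q z r ∧ R.d q z = 1 ∧ R.d p z = R.d p q - 1 := by
  obtain ⟨n, hn⟩ := Int.eq_ofNat_of_zero_le (R.d_nonneg q r)
  induction n generalizing q with
  | zero =>
    have := R.d_congr_right (x := p) hn
    omega
  | succ n ih =>
    obtain ⟨v, -, -, -, v1, v2⟩ := R.exists_first_step (x := q) (y := r) (by omega)
    have hp := R.d_nonneg p r
    have s1 := R.d_tri p q v
    have s2 := R.d_tri p v q
    have s3 := R.d_comm v q
    by_cases h1 : R.d p v = R.d p q - 1
    · exact ⟨v, by simp only [Btw]; omega, v1, h1⟩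
    obtain ⟨z, z1, z2, z3⟩ := ih (q := v) (by omega) (by omega)
    simp only [Btw] at z1 ⊢
    by_cases h2 : R.d p v = R.d p q
    · obtain ⟨z', y1, y2, y3⟩ := R.triangle_condition v1 h2.symm (by omega)
      have := R.predecessors_clique y2 z2 (by omega) z3
      have := R.d_tri z' z r
      have := R.d_tri q z' r
      exact ⟨z', by omega, y1, y3⟩
    · have := R.predecessors_clique (u := q) (by omega) z2 (by omega) z3
      have := R.d_tri q z r
      omega

/-- `p q r` is a metric triangle: the three intervals meet pairwise only in the vertices. -/
def MetricTriangle (p q r : X) : Prop :=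
  (∀ w, R.Btw p w q → R.Btw p w r → R.d p w = 0) ∧
  (∀ w, R.Btw q w r → R.Btw q w p → R.d q w = 0) ∧
  (∀ w, R.Btw r w p → R.Btw r w q → R.d r w = 0)

variable {R}

lemma MetricTriangle.rotate {p q r : X} (h : R.MetricTriangle p q r) : R.MetricTriangle q r p :=
  ⟨h.2.1, h.2.2, h.1⟩

lemma MetricTriangle.reverse {p q r : X} (h : R.MetricTriangle p q r) : R.MetricTriangle r q p :=
  ⟨fun w h1 h2 => h.2.2 w h2 h1, fun w h1 h2 => h.2.1 w h2 h1, fun w h1 h2 => h.1 w h2 h1⟩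

lemma MetricTriangle.d_le {p q r : X} (h : R.MetricTriangle p q r) : R.d p q ≤ R.d p r := by
  by_contra! hlt
  obtain ⟨z, z1, z2, z3⟩ := R.exists_step_descending hlt
  have := R.d_comm p q
  have := R.d_comm p z
  have := h.2.1 z z1 (by simp only [Btw]; omega)
  omega

lemma MetricTriangle.d_eq {p q r : X} (h : R.MetricTriangle p q r) :
    R.d p q = R.d p r ∧ R.d p q = R.d q r := by
  have h1 := h.d_le
  have h2 := h.rotate.d_le
  have h3 := h.rotate.rotate.d_le
  have := R.d_comm p q
  have := R.d_comm p r
  have := R.d_comm q r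
  omega

lemma MetricTriangle.equidistant {p q r w : X} (h : R.MetricTriangle p q r) (hw : R.Btw q w r) :
    R.d p w = R.d p q := by
  have := h.d_eq
  rcases lt_trichotomy (R.d p w) (R.d p q) with hlt | heq | hgt
  · obtain ⟨z, z1, z2, z3⟩ := R.exists_step_descending hlt
    have := R.d_comm p q
    have := R.d_comm p z
    have := h.2.1 z (hw.trans_left R z1) (by simp only [Btw]; omega)
    omega
  · exact heq
  · obtain ⟨z, z1, z2, z3⟩ := R.exists_step_descending hgt
    obtain ⟨z', y1, y2, y3⟩ := R.exists_step_descending (p := p) (q := w) (r := r) (by omega)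
    have := R.predecessors_clique z2 y2 z3 y3
    have := R.d_tri q z r
    have := R.d_tri z z' r
    have := R.d_comm z q
    have := R.d_comm w q
    simp only [Btw] at *
    omega

variable (R) in
/-- `p q r` is a quasi-median of `x y z`. -/
def QuasiMedian (x y z p q r : X) : Prop :=
  R.d x p + R.d p q + R.d q y = R.d x y ∧ R.d y q + R.d q r + R.d r z = R.d y z ∧
  R.d z r + R.d r p + R.d p x = R.d z x ∧ R.MetricTriangle p q r

variable (R) in
lemma exists_quasiMedian (x y z : X) : ∃ p q r, R.QuasiMedian x y z p q r := by
  let P : ℤ → Prop := fun n => ∃ p q r, R.d p q + R.d q r + R.d r p = n ∧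
    R.d x p + R.d p q + R.d q y = R.d x y ∧ R.d y q + R.d q r + R.d r z = R.d y z ∧
    R.d z r + R.d r p + R.d p x = R.d z x
  obtain ⟨n, ⟨p, q, r, rfl, h1, h2, h3⟩, hmin⟩ : ∃ n, P n ∧ ∀ m, P m → n ≤ m := by
    refine Int.exists_least_of_bdd ⟨0, ?_⟩ ⟨_, x, y, z, rfl, ?_⟩
    · rintro m ⟨p, q, r, rfl, -⟩
      have := R.d_nonneg p q
      have := R.d_nonneg q r
      have := R.d_nonneg r p
      omega
    · simp [R.d_self]
  have cx := R.d_comm p x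
  have cy := R.d_comm q y
  have cz := R.d_comm r z
  have cp := R.d_comm p q
  have cq := R.d_comm q r
  have cr := R.d_comm r p
  refine ⟨p, q, r, h1, h2, h3, fun w w1 w2 => ?_, fun w w1 w2 => ?_, fun w w1 w2 => ?_⟩
  · have n0 := R.d_nonneg p w
    have c1 := R.d_comm w x
    have c2 := R.d_comm w r
    have t1 := R.d_tri x p w
    have t2 := R.d_tri x w q
    have t3 := R.d_tri x q y
    have t4 := R.d_tri x w r
    have t5 := R.d_tri x r z
    have c3 := R.d_comm x z
    simp only [Btw] at w1 w2
    have := hmin _ ⟨w, q, r, rfl, by omega, by omega, by omega⟩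
    omega
  · have n0 := R.d_nonneg q w
    have c1 := R.d_comm w y
    have c2 := R.d_comm w p
    have t1 := R.d_tri y q w
    have t2 := R.d_tri y w r
    have t3 := R.d_tri y r z
    have t4 := R.d_tri y w p
    have t5 := R.d_tri y p x
    have c3 := R.d_comm x y
    simp only [Btw] at w1 w2
    have := hmin _ ⟨p, w, r, rfl, by omega, by omega, by omega⟩
    omega
  · have n0 := R.d_nonneg r w
    have c1 := R.d_comm w z
    have c2 := R.d_comm w q
    have t1 := R.d_tri z r w
    have t2 := R.d_tri z w p
    have t3 := R.d_tri z p x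
    have t4 := R.d_tri z w q
    have t5 := R.d_tri z q y
    have c3 := R.d_comm y z
    simp only [Btw] at w1 w2
    have := hmin _ ⟨p, q, w, rfl, by omega, by omega, by omega⟩
    omega

variable (R) in
lemma Btw.of_four {x p q y : X} (h : R.d x p + R.d p q + R.d q y = R.d x y) :
    R.Btw x p y ∧ R.Btw x q y := by
  have := R.d_tri x p y
  have := R.d_tri x q y
  have := R.d_tri p q y
  have := R.d_tri x p q
  simp only [Btw]
  omega

/-- Two metric triangles on a common side have their apexes on the boundary of a tripod at each
endpoint of that side. -/
lemma MetricTriangle.exists_tripod {p q q' r : X} (h : R.MetricTriangle p q r)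
    (h' : R.MetricTriangle p q' r) :
    ∃ m, R.Btw p m q ∧ R.Btw p m q' ∧ R.Btw q m q' := by
  obtain ⟨m, u, u', h1, h2, h3, hm⟩ := R.exists_quasiMedian p q q'
  have cp := R.d_comm m p
  have cq := R.d_comm u q
  have cq' := R.d_comm u' q'
  have cu' := R.d_comm m u'
  have cu := R.d_comm m u
  have cpq' := R.d_comm p q'
  have hd := hm.d_eq
  by_cases h0 : R.d m u = 0
  · have := R.d_tri q m q'
    have := R.d_tri q u m
    have := R.d_tri m u' q'
    have b := (Btw.of_four R h1).1
    have b' := (Btw.of_four R (x := p) (p := m) (q := u') (y := q') (by omega)).1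
    exact ⟨m, b, b', by simp only [Btw]; omega⟩
  · exfalso
    obtain ⟨v, -, -, -, v1, v2⟩ := R.exists_first_step h0
    have hv : R.Btw m v u := by simp only [Btw]; omega
    have e := hm.rotate.rotate.equidistant hv
    obtain ⟨z, z1, z2, z3⟩ := R.triangle_condition v1 e.symm (by omega)
    have czu := R.d_comm u' z
    have cuv := R.d_comm u' v
    have b1 := Btw.of_four R h1
    have b2 := Btw.of_four R (x := p) (p := m) (q := u') (y := q') (by omega)
    have hvpq : R.Btw p v q := b1.2.trans_left R
      (Btw.trans_right R (v := m) (by simp only [Btw] at *; omega) hv)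
    have hzpq : R.Btw p z q' := b2.2.trans_left R
      (Btw.trans_right R (v := m) (by simp only [Btw] at *; omega) (by simp only [Btw]; omega))
    have k1 := h.rotate.rotate.equidistant b1.1
    have k2 := h.rotate.rotate.equidistant hvpq
    have k3 := h'.rotate.rotate.equidistant hzpq
    have := R.d_comm z m
    exact R.no_equidistant_triangle (w := r) v1 z2 (by omega) (by omega) (by omega)

end RankThree

/-- A left-invariant order with positive cone `pos` on a group, satisfying Riesz interpolation, with
a degree and a Garside element `δ` of degree three. -/
structure GarsideOrder (G : Type*) [Group G] where
  /-- the positive cone -/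
  pos : Submonoid G
  /-- the degree -/
  deg : G → ℤ
  /-- the Garside element -/
  δ : G
  deg_mul : ∀ g h, deg (g * h) = deg g + deg h
  deg_δ : deg δ = 3
  δ_mem : δ ∈ pos
  deg_nonneg : ∀ g ∈ pos, 0 ≤ deg g
  eq_one : ∀ g ∈ pos, deg g = 0 → g = 1
  conj_mem : ∀ g ∈ pos, δ * g * δ⁻¹ ∈ pos
  conj_mem' : ∀ g ∈ pos, δ⁻¹ * g * δ ∈ pos
  bounded : ∀ g : G, ∃ n : ℤ, g * δ ^ n ∈ pos
  interp : ∀ x₁ x₂ y₁ y₂ : G, x₁⁻¹ * y₁ ∈ pos → x₁⁻¹ * y₂ ∈ pos → x₂⁻¹ * y₁ ∈ pos →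
    x₂⁻¹ * y₂ ∈ pos → ∃ z, x₁⁻¹ * z ∈ pos ∧ x₂⁻¹ * z ∈ pos ∧ z⁻¹ * y₁ ∈ pos ∧ z⁻¹ * y₂ ∈ pos

namespace GarsideOrder

variable {G : Type*} [Group G] (O : GarsideOrder G)

lemma deg_one : O.deg 1 = 0 := by simpa using O.deg_mul 1 1

lemma deg_inv (g : G) : O.deg g⁻¹ = -O.deg g := by
  have := O.deg_mul g g⁻¹
  rw [mul_inv_cancel, deg_one] at this
  omega

lemma deg_zpow (n : ℤ) : O.deg (O.δ ^ n) = 3 * n := by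
  induction n with
  | zero => simp [deg_one]
  | succ n ih => rw [zpow_add_one, O.deg_mul, ih, O.deg_δ]; ring
  | pred n ih => rw [zpow_sub_one, O.deg_mul, ih, O.deg_inv, O.deg_δ]; ring

lemma zpow_mem_iff (n : ℤ) : O.δ ^ n ∈ O.pos ↔ 0 ≤ n := by
  constructor
  · intro h
    have := O.deg_nonneg _ h
    rw [O.deg_zpow] at this
    omega
  · intro h
    obtain ⟨k, rfl⟩ := Int.eq_ofNat_of_zero_le h
    simpa using pow_mem O.δ_mem k

lemma conj_zpow_mem (n : ℤ) {g : G} (hg : g ∈ O.pos) : O.δ ^ n * g * (O.δ ^ n)⁻¹ ∈ O.pos := by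
  induction n with
  | zero => simpa
  | succ n ih =>
    have := O.conj_mem _ ih
    rw [add_comm, zpow_add, zpow_one]
    simpa [mul_assoc] using this
  | pred n ih =>
    have := O.conj_mem' _ ih
    rw [sub_eq_add_neg, add_comm, zpow_add, zpow_neg_one]
    simpa [mul_assoc] using this

lemma exists_threshold (g : G) : ∃ k : ℤ, ∀ m : ℤ, g * O.δ ^ m ∈ O.pos ↔ k ≤ m := by
  obtain ⟨k, hk, hmin⟩ : ∃ k : ℤ, g * O.δ ^ k ∈ O.pos ∧
      ∀ m : ℤ, g * O.δ ^ m ∈ O.pos → k ≤ m := by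
    refine Int.exists_least_of_bdd ⟨-|O.deg g|, fun m hm => ?_⟩ (O.bounded g)
    have := O.deg_nonneg _ hm
    rw [O.deg_mul, O.deg_zpow] at this
    have := le_abs_self (O.deg g)
    have := abs_nonneg (O.deg g)
    omega
  refine ⟨k, fun m => ⟨hmin m, fun hm => ?_⟩⟩
  have := mul_mem hk ((O.zpow_mem_iff (m - k)).2 (by omega))
  rwa [mul_assoc, ← zpow_add, add_sub_cancel] at this

/-- The least `k` with `1 ≤ g δ ^ k`. -/
noncomputable def threshold (g : G) : ℤ := (O.exists_threshold g).choose

lemma mem_iff (g : G) (m : ℤ) : g * O.δ ^ m ∈ O.pos ↔ O.threshold g ≤ m :=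
  (O.exists_threshold g).choose_spec m

lemma conj_zpow_mem_iff (n : ℤ) {g : G} : O.δ ^ n * g * (O.δ ^ n)⁻¹ ∈ O.pos ↔ g ∈ O.pos := by
  refine ⟨fun h => ?_, O.conj_zpow_mem n⟩
  have := O.conj_zpow_mem (-n) h
  simpa [mul_assoc] using this

/-- The rank three geometry of a Garside order. -/
@[simps ι ht]
noncomputable def rankThree : RankThree G where
  ι x y := O.threshold (x⁻¹ * y)
  ht := O.deg
  ι_self x := by
    rw [inv_mul_cancel]
    refine le_antisymm ((O.mem_iff 1 0).1 (by simp [one_mem])) ?_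
    have := (O.mem_iff 1 _).2 le_rfl
    rwa [one_mul, O.zpow_mem_iff] at this
  ι_tri x y z := by
    rw [← O.mem_iff]
    have h1 := (O.mem_iff (x⁻¹ * y) _).2 le_rfl
    have h2 := (O.mem_iff (y⁻¹ * z) _).2 le_rfl
    have := mul_mem h1 (O.conj_zpow_mem (-O.threshold (x⁻¹ * y)) h2)
    convert this using 1
    simp only [zpow_add, zpow_neg]
    group
  ht_le x y := by
    have := O.deg_nonneg _ ((O.mem_iff (x⁻¹ * y) _).2 le_rfl)
    rw [O.deg_mul, O.deg_mul, O.deg_inv, O.deg_zpow] at this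
    omega
  ht_eq x y h := by
    have := O.eq_one _ ((O.mem_iff (x⁻¹ * y) _).2 le_rfl) (by
      rw [O.deg_mul, O.deg_mul, O.deg_inv, O.deg_zpow]; omega)
    have e : y⁻¹ * x = O.δ ^ (O.threshold (x⁻¹ * y)) := by
      rw [mul_eq_one_iff_eq_inv] at this
      rw [← inv_inj, ← this]
      group
    rw [e]
    set k := O.threshold (x⁻¹ * y)
    have h1 := (O.mem_iff (O.δ ^ k) (-k)).1 (by simp [one_mem])
    have h2 := (O.mem_iff (O.δ ^ k) _).2 le_rfl
    rw [← zpow_add, O.zpow_mem_iff] at h2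
    omega
  interp x₁ x₂ y₁ y₂ s₁ s₂ t₁ t₂ h11 h12 h21 h22 := by
    have key : ∀ (x y : G) (s t : ℤ), O.threshold (x⁻¹ * y) ≤ s + t →
        (x * O.δ ^ (-s))⁻¹ * (y * O.δ ^ t) ∈ O.pos := by
      intro x y s t h
      rw [← O.mem_iff] at h
      convert O.conj_zpow_mem s h using 1
      simp only [zpow_add, zpow_neg]
      group
    obtain ⟨z, z1, z2, z3, z4⟩ := O.interp _ _ _ _ (key _ _ _ _ h11) (key _ _ _ _ h12)
      (key _ _ _ _ h21) (key _ _ _ _ h22)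
    refine ⟨z, ?_, ?_, ?_, ?_⟩
    · rw [← O.mem_iff, ← O.conj_zpow_mem_iff s₁]
      convert z1 using 1
      simp only [zpow_neg]
      group
    · rw [← O.mem_iff, ← O.conj_zpow_mem_iff s₂]
      convert z2 using 1
      simp only [zpow_neg]
      group
    · rw [← O.mem_iff, mul_assoc]
      exact z3
    · rw [← O.mem_iff, mul_assoc]
      exact z4

/-- The symmetrized metric on the group. -/
noncomputable abbrev d (x y : G) : ℤ := O.rankThree.d x y

/-- Metric intervals in the group. -/
abbrev Btw (x y z : G) : Prop := O.rankThree.Btw x y z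

lemma ι_mul_left (g x y : G) : O.rankThree.ι (g * x) (g * y) = O.rankThree.ι x y := by
  simp [mul_assoc]

lemma d_mul_left (g x y : G) : O.d (g * x) (g * y) = O.d x y := by
  simp only [d, RankThree.d, ι_mul_left]

lemma d_comm (x y : G) : O.d x y = O.d y x := O.rankThree.d_comm x y

lemma d_one_inv (g : G) : O.d 1 g⁻¹ = O.d 1 g := by
  rw [← O.d_mul_left g, mul_one, mul_inv_cancel, d, RankThree.d_comm]

lemma d_eq_one (x y : G) : O.d x y = O.d 1 (x⁻¹ * y) := by
  rw [← O.d_mul_left x⁻¹, inv_mul_cancel]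

lemma btw_mul_left (g x y z : G) : O.Btw (g * x) (g * y) (g * z) ↔ O.Btw x y z := by
  simp only [Btw, RankThree.Btw]
  rw [← d, ← d, ← d, d_mul_left, d_mul_left, d_mul_left]

lemma eq_of_d_eq_zero {x y : G} (h : O.d x y = 0) (hd : O.deg x = O.deg y) : x = y := by
  have h1 := O.rankThree.ht_eq_of_d_eq_zero h
  simp only [rankThree_ht, rankThree_ι] at h1
  have h2 : O.threshold (x⁻¹ * y) = 0 := by omega
  have := O.eq_one _ ((O.mem_iff (x⁻¹ * y) 0).2 h2.le)
  rw [zpow_zero, mul_one, O.deg_mul, O.deg_inv] at this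
  exact inv_mul_eq_one.1 (this (by omega))

lemma d_zpow (x : G) (n : ℤ) : O.d x (x * O.δ ^ n) = 0 := by
  rw [d_eq_one, inv_mul_cancel_left]
  simp only [d, RankThree.d, rankThree_ι, inv_one, one_mul, mul_one]
  have h1 := (O.mem_iff (O.δ ^ n) (-n)).1 (by simp [one_mem])
  have h2 := (O.mem_iff (O.δ ^ n)⁻¹ n).1 (by simp [one_mem])
  have h3 := O.rankThree.d_nonneg 1 (O.δ ^ n)
  simp only [RankThree.d, rankThree_ι, inv_one, one_mul, mul_one] at h3
  omega

/-- Every point can be moved by a power of `δ` so that its degree lies in `{0, 1, 2}`. -/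
lemma exists_normalized (g x : G) :
    ∃ y, (∀ z, O.d z y = O.d z x) ∧ (∀ z, O.d y z = O.d x z) ∧
      0 ≤ O.deg (g * y) ∧ O.deg (g * y) ≤ 2 := by
  refine ⟨x * O.δ ^ (-(O.deg (g * x) / 3)), fun z => ?_, fun z => ?_, ?_, ?_⟩
  · exact (O.rankThree.d_congr_right (O.d_zpow _ _)).symm
  · exact (O.rankThree.d_congr_left (O.d_zpow _ _)).symm
  all_goals
    rw [← mul_assoc, O.deg_mul, O.deg_zpow]
    omega

open Classical in
/-- Intervals have polynomially many points of bounded degree. -/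
lemma tsum_btw_le {m : G} {K : ℕ} (hm : O.d 1 m ≤ K) :
    ∑' v, (if O.Btw 1 v m ∧ |O.deg v| ≤ K then 1 else 0 : ENNReal) ≤ ((3 * K + 1) ^ 3 : ℕ) := by
  rw [ENNReal.tsum_eq_iSup_sum]
  refine iSup_le fun s => ?_
  rw [Finset.sum_boole, Nat.cast_le]
  have hcard : (Finset.Icc (0 : ℤ) (3 * K) ×ˢ Finset.Icc (-K : ℤ) (2 * K) ×ˢ
      Finset.Icc (-K : ℤ) (2 * K)).card = (3 * K + 1) ^ 3 := by
    have e1 : (3 * K + 1 - 0 : ℤ).toNat = 3 * K + 1 := by omega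
    have e2 : (2 * K + 1 - -K : ℤ).toNat = 3 * K + 1 := by omega
    simp only [Finset.card_product, Int.card_Icc, e1, e2]
    ring
  rw [← hcard]
  refine Finset.card_le_card_of_injOn
    (fun v => (O.d 1 v, O.rankThree.ι 1 v, O.deg v)) ?_ ?_
  · intro v hv
    obtain ⟨-, h1, h2⟩ := Finset.mem_filter.1 hv
    have t1 := O.rankThree.ht_le 1 v
    have t2 := O.rankThree.ht_le v 1
    have t3 := O.rankThree.d_nonneg v m
    have t4 := O.rankThree.d_nonneg 1 v
    simp only [Btw, RankThree.Btw, d] at h1 hm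
    rw [abs_le] at h2
    simp only [rankThree_ht, O.deg_one, RankThree.d] at *
    simp only [Finset.coe_product, Set.mem_prod, Finset.coe_Icc, Set.mem_Icc]
    refine ⟨⟨t4, ?_⟩, ⟨?_, ?_⟩, ?_, ?_⟩ <;> omega
  · intro u hu v hv huv
    obtain ⟨-, h1, h2⟩ := Finset.mem_filter.1 hu
    obtain ⟨-, h3, h4⟩ := Finset.mem_filter.1 hv
    simp only [Prod.mk.injEq] at huv
    exact O.eq_of_d_eq_zero (O.rankThree.btw_rigid h1 h3 huv.1 huv.2.1 huv.2.2) huv.2.2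

end GarsideOrder

namespace ENNReal

lemma rpow_half_sq (x : ENNReal) : (x ^ (1 / 2 : ℝ)) ^ 2 = x := by
  rw [← ENNReal.rpow_natCast, ← ENNReal.rpow_mul]
  norm_num

lemma sq_tsum_mul_le {ι : Type*} (f g : ι → ENNReal) :
    (∑' i, f i * g i) ^ 2 ≤ (∑' i, f i ^ 2) * ∑' i, g i ^ 2 := by
  let _ : MeasurableSpace ι := ⊤
  have h := ENNReal.lintegral_mul_le_Lp_mul_Lq (MeasureTheory.Measure.count (α := ι))
    Real.HolderConjugate.two_two (f := f) (g := g) (measurable_from_top.aemeasurable)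
    (measurable_from_top.aemeasurable)
  simp only [MeasureTheory.lintegral_count, Pi.mul_apply, ENNReal.rpow_two] at h
  calc _ ≤ _ := pow_le_pow_left₀ (zero_le) h 2
    _ = _ := by rw [mul_pow, rpow_half_sq, rpow_half_sq]

/-- The Hilbert–Schmidt inequality `|tr (F G H)| ≤ ‖F‖ ‖G‖ ‖H‖`, for nonnegative kernels. -/
lemma sq_tsum_kernel_le {ι : Type*} (F G H : ι → ι → ENNReal) :
    (∑' x, ∑' y, ∑' z, F x y * G y z * H x z) ^ 2 ≤
      (∑' x, ∑' y, F x y ^ 2) * (∑' x, ∑' y, G x y ^ 2) * ∑' x, ∑' y, H x y ^ 2 := by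
  have e : ∑' x, ∑' y, ∑' z, F x y * G y z * H x z =
      ∑' p : ι × ι, (∑' y, F p.1 y * G y p.2) * H p.1 p.2 := by
    rw [ENNReal.tsum_prod']
    refine tsum_congr fun x => ?_
    rw [ENNReal.tsum_comm]
    simp_rw [ENNReal.tsum_mul_right]
  rw [e]
  refine (sq_tsum_mul_le _ _).trans (mul_le_mul' ?_ (ENNReal.tsum_prod' ..).le)
  rw [ENNReal.tsum_prod', ENNReal.tsum_comm (f := fun x y => G x y ^ 2)]
  calc ∑' x, ∑' z, (∑' y, F x y * G y z) ^ 2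
      ≤ ∑' x, ∑' z, (∑' y, F x y ^ 2) * ∑' y, G y z ^ 2 :=
        ENNReal.tsum_le_tsum fun x => ENNReal.tsum_le_tsum fun z => sq_tsum_mul_le _ _
    _ = _ := by simp_rw [ENNReal.tsum_mul_left, ENNReal.tsum_mul_right]

lemma le_of_sq_le_sq {x y : ENNReal} (h : x ^ 2 ≤ y ^ 2) : x ≤ y :=
  le_of_not_gt fun hlt => (ENNReal.pow_right_strictMono two_ne_zero hlt).not_ge h

end ENNReal

namespace GarsideOrder

variable {G : Type*} [Group G] (O : GarsideOrder G)

open Classical in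
/-- The restriction of `φ ((a * l)⁻¹)` to the pairs for which `l⁻¹` is a point of the interval from
`1` to `(a * l)⁻¹` of bounded degree. -/
noncomputable def tripodKernel (φ : G → ENNReal) (a l : G) : ENNReal :=
  if O.Btw 1 l⁻¹ (a * l)⁻¹ ∧ 0 ≤ O.deg l⁻¹ ∧ O.deg l⁻¹ ≤ 2 then φ (a * l)⁻¹ else 0

lemma tsum_tripodKernel_le {φ : G → ENNReal} {K : ℕ} (hK : 2 ≤ K)
    (hφ : ∀ t, φ t ≠ 0 → O.d 1 t ≤ K) :
    ∑' a, ∑' l, O.tripodKernel φ a l ^ 2 ≤ ((3 * K + 1) ^ 3 : ℕ) * ∑' t, φ t ^ 2 := by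
  classical
  calc ∑' a, ∑' l, O.tripodKernel φ a l ^ 2
      = ∑' l, ∑' a, O.tripodKernel φ a l ^ 2 := ENNReal.tsum_comm
    _ = ∑' l, ∑' t, O.tripodKernel φ (t⁻¹ * l) l⁻¹ ^ 2 := by
        rw [← (Equiv.inv G).tsum_eq]
        refine tsum_congr fun l => ?_
        rw [← ((Equiv.inv G).trans (Equiv.mulRight l)).tsum_eq]
        rfl
    _ = ∑' t, ∑' l, O.tripodKernel φ (t⁻¹ * l) l⁻¹ ^ 2 := ENNReal.tsum_comm
    _ ≤ ∑' t, ∑' l, φ t ^ 2 * (if O.Btw 1 l t ∧ |O.deg l| ≤ K then 1 else 0 : ENNReal) := by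
        refine ENNReal.tsum_le_tsum fun t => ENNReal.tsum_le_tsum fun l => ?_
        simp only [tripodKernel, inv_inv, mul_inv_cancel_right]
        by_cases h : O.Btw 1 l t ∧ 0 ≤ O.deg l ∧ O.deg l ≤ 2
        · rw [if_pos h, if_pos ⟨h.1, by rw [abs_le]; omega⟩, mul_one]
        · simp [if_neg h]
    _ ≤ ∑' t, φ t ^ 2 * ((3 * K + 1) ^ 3 : ℕ) := by
        refine ENNReal.tsum_le_tsum fun t => ?_
        rw [ENNReal.tsum_mul_left]
        by_cases h : φ t = 0
        · simp [h]
        · exact mul_le_mul_right (O.tsum_btw_le (hφ t h)) _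
    _ = _ := by rw [ENNReal.tsum_mul_right, mul_comm]

open Classical in
/-- The contribution of one tripod endpoint, as a function of the displacement of the apexes. -/
noncomputable def tripodSum (φ : G → ENNReal) (K : ℕ) (m : G) : ENNReal :=
  ∑' a, ∑' l, if O.Btw 1 a m ∧ O.d 1 m ≤ K then
    O.tripodKernel φ a l * O.tripodKernel φ (m⁻¹ * a) l else 0

lemma tsum_tripodSum_le {φ : G → ENNReal} {K : ℕ} (hK : 2 ≤ K)
    (hφ : ∀ t, φ t ≠ 0 → O.d 1 t ≤ K ∧ |O.deg t| + 2 ≤ K) :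
    ∑' m, O.tripodSum φ K m ^ 2 ≤ ((3 * K + 1) ^ 3 : ℕ) ^ 3 * (∑' t, φ t ^ 2) ^ 2 := by
  classical
  set N : ENNReal := (((3 * K + 1) ^ 3 : ℕ) : ENNReal)
  set Φ : G → ENNReal := fun a => ∑' l, O.tripodKernel φ a l ^ 2 with hΦ
  have key : ∀ m, O.tripodSum φ K m ^ 2 ≤ N * ∑' a, Φ a * Φ (m⁻¹ * a) := by
    intro m
    by_cases hm : O.d 1 m ≤ K
    · have h1 : O.tripodSum φ K m ≤ ∑' a, (if O.Btw 1 a m ∧ |O.deg a| ≤ K then 1 else 0) *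
          ∑' l, O.tripodKernel φ a l * O.tripodKernel φ (m⁻¹ * a) l := by
        refine ENNReal.tsum_le_tsum fun a => ?_
        rw [← ENNReal.tsum_mul_left]
        refine ENNReal.tsum_le_tsum fun l => ?_
        by_cases hb : O.Btw 1 a m ∧ |O.deg a| ≤ K
        · simp [hb, hm]
        · rw [if_neg hb, zero_mul]
          split_ifs with h2
          · have : O.tripodKernel φ a l = 0 := by
              by_contra h3
              simp only [tripodKernel] at h3
              split_ifs at h3 with h4
              · have := (hφ _ h3).2
                rw [O.deg_inv, O.deg_mul, abs_neg, ← le_sub_iff_add_le, abs_le] at this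
                have h5 := h4.2
                rw [O.deg_inv] at h5
                exact hb ⟨h2.1, by rw [abs_le]; omega⟩
              · exact h3 rfl
            simp [this]
          · exact le_rfl
      refine (pow_le_pow_left₀ zero_le h1 2).trans ((ENNReal.sq_tsum_mul_le _ _).trans ?_)
      refine mul_le_mul' ?_ (ENNReal.tsum_le_tsum fun a => ENNReal.sq_tsum_mul_le _ _)
      simpa only [ite_pow, one_pow, ne_eq, OfNat.ofNat_ne_zero, not_false_eq_true, zero_pow]
        using O.tsum_btw_le hm
    · simp [tripodSum, hm]
  calc ∑' m, O.tripodSum φ K m ^ 2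
      ≤ ∑' m, N * ∑' a, Φ a * Φ (m⁻¹ * a) := ENNReal.tsum_le_tsum key
    _ = N * ∑' a, ∑' m, Φ a * Φ (m⁻¹ * a) := by rw [ENNReal.tsum_mul_left, ENNReal.tsum_comm]
    _ = N * ∑' a, ∑' m, Φ a * Φ m := by
        congr 1
        refine tsum_congr fun a => ?_
        exact ((Equiv.inv G).trans (Equiv.mulRight a)).tsum_eq fun m => Φ a * Φ m
    _ = N * (∑' a, Φ a) ^ 2 := by
        simp_rw [ENNReal.tsum_mul_left, ENNReal.tsum_mul_right, sq]
    _ ≤ N * (N * ∑' t, φ t ^ 2) ^ 2 :=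
        mul_le_mul_right (pow_le_pow_left₀ zero_le
          (O.tsum_tripodKernel_le hK fun t ht => (hφ t ht).1) 2) _
    _ = _ := by ring

open Classical in
/-- A trilinear estimate for sums over metric triangles. -/
lemma sq_tsum_metricTriangle_le {φ ψ χ : G → ENNReal} {K : ℕ} (hK : 2 ≤ K)
    (hφ : ∀ t, φ t ≠ 0 → 2 * O.d 1 t ≤ K ∧ |O.deg t| + 2 ≤ K)
    (hψ : ∀ t, ψ t ≠ 0 → 2 * O.d 1 t ≤ K ∧ |O.deg t| + 2 ≤ K) :
    (∑' s, ∑' t, if O.rankThree.MetricTriangle 1 s (s * t) then φ s * ψ t * χ (s * t) else 0) ^ 2 ≤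
      ((3 * K + 1) ^ 3 : ℕ) ^ 3 * (∑' t, φ t ^ 2) * (∑' t, ψ t ^ 2) * ∑' t, χ t ^ 2 := by
  set N : ENNReal := (((3 * K + 1) ^ 3 : ℕ) : ENNReal)
  set A : G → G → ENNReal := fun r s =>
    if O.rankThree.MetricTriangle 1 s r then φ s * ψ (s⁻¹ * r) else 0 with hA
  set ψ' : G → ENNReal := fun t => ψ t⁻¹ with hψ'
  have e1 : ∑' s, ∑' t, (if O.rankThree.MetricTriangle 1 s (s * t) then
      φ s * ψ t * χ (s * t) else 0) = ∑' r, χ r * ∑' s, A r s := by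
    simp_rw [← ENNReal.tsum_mul_left]
    rw [ENNReal.tsum_comm (f := fun r s => χ r * A r s)]
    refine tsum_congr fun s => ?_
    rw [← (Equiv.mulLeft s⁻¹).tsum_eq]
    refine tsum_congr fun r => ?_
    simp only [Equiv.coe_mulLeft, mul_inv_cancel_left, hA, mul_ite, mul_zero]
    rw [mul_comm (χ r)]
  set Θ : G × G × G × G × G → ENNReal := fun p =>
    (if O.Btw 1 p.2.1 p.1 ∧ O.d 1 p.1 ≤ K then O.tripodKernel φ p.2.1 p.2.2.1 *
      O.tripodKernel φ (p.1⁻¹ * p.2.1) p.2.2.1 else 0) *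
    (if O.Btw 1 p.2.2.2.1 p.1 ∧ O.d 1 p.1 ≤ K then O.tripodKernel ψ' p.2.2.2.1 p.2.2.2.2 *
      O.tripodKernel ψ' (p.1⁻¹ * p.2.2.2.1) p.2.2.2.2 else 0) with hΘ
  set e : G × G × G × G × G → G × G × G × G × G := fun p =>
    (p.2.1⁻¹ * p.2.2.1, p.2.1⁻¹ * p.2.2.2.1⁻¹, p.2.2.2.1, p.2.1⁻¹ * p.1 * p.2.2.2.2⁻¹,
      p.2.2.2.2) with he
  have he_inj : Function.Injective e := by
    rintro ⟨r, s, s', l, u⟩ ⟨r', t, t', l', u'⟩ h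
    simp only [he, Prod.mk.injEq] at h
    obtain ⟨h1, h2, rfl, h4, rfl⟩ := h
    have h5 : s = t := inv_injective (mul_right_cancel h2)
    subst h5
    have h6 := mul_left_cancel h1
    have h7 := mul_left_cancel (mul_right_cancel h4)
    rw [h6, h7]
  have hterm : ∀ r s s', A r s * A r s' ≤ ∑' l, ∑' u, Θ (e (r, s, s', l, u)) := by
    intro r s s'
    by_cases h1 : O.rankThree.MetricTriangle 1 s r
    swap
    · simp [hA, h1]
    by_cases h2 : O.rankThree.MetricTriangle 1 s' r
    swap
    · simp [hA, h2]
    by_cases h3 : φ s = 0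
    · simp [hA, h3]
    by_cases h4 : φ s' = 0
    · simp [hA, h4]
    obtain ⟨m, m1, m2, m3⟩ := h1.exists_tripod h2
    obtain ⟨n, n1, n2, n3⟩ := h1.reverse.exists_tripod h2.reverse
    obtain ⟨p, p1, p2, p3, p4⟩ := O.exists_normalized 1 m
    obtain ⟨q, q1, q2, q3, q4⟩ := O.exists_normalized r⁻¹ n
    rw [one_mul] at p3 p4
    have hb : ∀ x z, O.rankThree.Btw x m z → O.Btw x p z := by
      intro x z h
      have := p1 x
      have := p2 z
      simp only [Btw, RankThree.Btw, d] at *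
      omega
    have hb' : ∀ x z, O.rankThree.Btw x n z → O.Btw x q z := by
      intro x z h
      have := q1 x
      have := q2 z
      simp only [Btw, RankThree.Btw, d] at *
      omega
    refine le_trans (le_of_eq ?_)
      ((ENNReal.le_tsum (q⁻¹ * r)).trans (ENNReal.le_tsum p⁻¹))
    have hd : O.d 1 (s⁻¹ * s') ≤ K := by
      have := O.rankThree.d_tri s 1 s'
      have := O.rankThree.d_comm s 1
      have := (hφ s h3).1
      have := (hφ s' h4).1
      rw [← d_eq_one]
      simp only [d] at *
      omega
    have b1 : O.Btw 1 (s⁻¹ * p) (s⁻¹ * s') := by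
      rw [← O.btw_mul_left s]
      simpa using hb _ _ m3
    have b2 : O.Btw 1 (s⁻¹ * q) (s⁻¹ * s') := by
      rw [← O.btw_mul_left s]
      simpa using hb' _ _ n3
    have b3 : O.Btw 1 (r⁻¹ * q) (r⁻¹ * s) := by
      rw [← O.btw_mul_left r]
      simpa using hb' _ _ n1
    have b4 : O.Btw 1 (r⁻¹ * q) (r⁻¹ * s') := by
      rw [← O.btw_mul_left r]
      simpa using hb' _ _ n2
    simp only [hΘ, he, hA, if_pos h1, if_pos h2, tripodKernel, hψ', mul_inv_rev, inv_inv,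
      mul_assoc, mul_inv_cancel_left, b1, b2, b3, b4, hd, hb _ _ m1, hb _ _ m2, p3, p4, q3, q4, and_self, if_true]
    ring
  rw [e1]
  calc (∑' r, χ r * ∑' s, A r s) ^ 2
      ≤ (∑' r, χ r ^ 2) * ∑' r, (∑' s, A r s) ^ 2 := ENNReal.sq_tsum_mul_le _ _
    _ = (∑' r, χ r ^ 2) * ∑' r, ∑' s, ∑' s', A r s * A r s' := by
        simp_rw [ENNReal.tsum_mul_left, ENNReal.tsum_mul_right, sq]
    _ ≤ (∑' r, χ r ^ 2) * ∑' r, ∑' s, ∑' s', ∑' l, ∑' u, Θ (e (r, s, s', l, u)) :=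
        mul_le_mul_right (ENNReal.tsum_le_tsum fun r => ENNReal.tsum_le_tsum fun s =>
          ENNReal.tsum_le_tsum fun s' => hterm r s s') _
    _ = (∑' r, χ r ^ 2) * ∑' p, Θ (e p) := by simp_rw [ENNReal.tsum_prod']
    _ ≤ (∑' r, χ r ^ 2) * ∑' p, Θ p :=
        mul_le_mul_right (ENNReal.tsum_comp_le_tsum_of_injective he_inj _) _
    _ = (∑' r, χ r ^ 2) * ∑' m, O.tripodSum φ K m * O.tripodSum ψ' K m := by
        simp_rw [ENNReal.tsum_prod', hΘ, tripodSum, ENNReal.tsum_mul_left, ENNReal.tsum_mul_right]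
    _ ≤ (∑' r, χ r ^ 2) * (N ^ 3 * (∑' t, φ t ^ 2) * ∑' t, ψ t ^ 2) := by
        refine mul_le_mul_right (ENNReal.le_of_sq_le_sq ?_) _
        have hn : ∀ t, 0 ≤ O.d 1 t := fun t => O.rankThree.d_nonneg 1 t
        have k1 := O.tsum_tripodSum_le hK (φ := φ) fun t ht => ⟨by
          have := (hφ t ht).1; have := hn t; omega, (hφ t ht).2⟩
        have k2 := O.tsum_tripodSum_le hK (φ := ψ') fun t ht => by
          have := hψ t⁻¹ ht
          rw [O.deg_inv, abs_neg, O.d_one_inv] at this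
          exact ⟨by have := hn t; omega, this.2⟩
        have k3 : ∑' t, ψ' t ^ 2 = ∑' t, ψ t ^ 2 := (Equiv.inv G).tsum_eq fun t => ψ t ^ 2
        rw [k3] at k2
        calc _ ≤ _ := ENNReal.sq_tsum_mul_le _ _
          _ ≤ _ := mul_le_mul' k1 k2
          _ = _ := by ring
    _ = _ := by ring

end GarsideOrder

namespace GarsideOrder

variable {G : Type*} [Group G] (O : GarsideOrder G)

/-- The elements between `δ ^ (-n)` and `δ ^ n`. -/
def Ball (n : ℤ) (g : G) : Prop := O.rankThree.ι 1 g ≤ n ∧ O.rankThree.ι g 1 ≤ n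

variable {O}

lemma Ball.mono {m n : ℤ} (hmn : m ≤ n) {g : G} (h : O.Ball m g) : O.Ball n g :=
  ⟨h.1.trans hmn, h.2.trans hmn⟩

lemma Ball.mul {m n : ℤ} {g h : G} (hg : O.Ball m g) (hh : O.Ball n h) :
    O.Ball (m + n) (g * h) := by
  have h1 := O.rankThree.ι_tri 1 g (g * h)
  have h2 := O.rankThree.ι_tri (g * h) g 1
  have h3 := O.ι_mul_left g 1 h
  have h4 := O.ι_mul_left g h 1
  rw [mul_one] at h3 h4
  obtain ⟨a1, a2⟩ := hg
  obtain ⟨b1, b2⟩ := hh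
  constructor <;> omega

lemma Ball.inv {n : ℤ} {g : G} (hg : O.Ball n g) : O.Ball n g⁻¹ := by
  have h3 := O.ι_mul_left g 1 g⁻¹
  have h4 := O.ι_mul_left g g⁻¹ 1
  rw [mul_one, mul_inv_cancel] at h3 h4
  exact ⟨h3 ▸ hg.2, h4 ▸ hg.1⟩

lemma Ball.d_le {n : ℤ} {g : G} (hg : O.Ball n g) : O.d 1 g ≤ 2 * n := by
  obtain ⟨h1, h2⟩ := hg
  simp only [d, RankThree.d]
  omega

lemma Ball.abs_deg_le {n : ℤ} {g : G} (hg : O.Ball n g) : |O.deg g| ≤ 3 * n := by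
  obtain ⟨h1, h2⟩ := hg
  have h3 := O.rankThree.ht_le 1 g
  have h4 := O.rankThree.ht_le g 1
  simp only [rankThree_ht, O.deg_one] at h3 h4
  rw [abs_le]
  omega

lemma ball_one : O.Ball 0 1 := ⟨(O.rankThree.ι_self 1).le, (O.rankThree.ι_self 1).le⟩

lemma exists_ball (g : G) : ∃ n : ℕ, O.Ball n g :=
  ⟨(max (O.rankThree.ι 1 g) (O.rankThree.ι g 1)).toNat,
    (le_max_left _ _).trans (Int.self_le_toNat _), (le_max_right _ _).trans (Int.self_le_toNat _)⟩

lemma exists_ball_finset (s : Finset G) : ∃ n : ℕ, ∀ g ∈ s, O.Ball n g := by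
  choose n hn using exists_ball (O := O)
  exact ⟨s.sup n, fun g hg => (hn g).mono (by exact_mod_cast Finset.le_sup (f := n) hg)⟩

lemma metricTriangle_congr {p p' q r : G} (hp : O.d p p' = 0)
    (h : O.rankThree.MetricTriangle p q r) : O.rankThree.MetricTriangle p' q r := by
  have h1 : ∀ z, O.rankThree.d z p' = O.rankThree.d z p := fun z =>
    (O.rankThree.d_congr_right hp).symm
  have h2 : ∀ z, O.rankThree.d p' z = O.rankThree.d p z := fun z =>
    (O.rankThree.d_congr_left hp).symm
  simpa only [RankThree.MetricTriangle, RankThree.Btw, h1, h2] using h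

lemma metricTriangle_mul_left (g : G) {p q r : G} (h : O.rankThree.MetricTriangle p q r) :
    O.rankThree.MetricTriangle (g * p) (g * q) (g * r) := by
  have key : ∀ {x y z : G}, (∀ w, O.Btw x w y → O.Btw x w z → O.d x w = 0) →
      ∀ w, O.Btw (g * x) w (g * y) → O.Btw (g * x) w (g * z) → O.d (g * x) w = 0 := by
    intro x y z hx w h1 h2
    rw [← mul_inv_cancel_left g w] at h1 h2 ⊢
    rw [O.btw_mul_left] at h1 h2
    rw [O.d_mul_left]
    exact hx _ h1 h2
  exact ⟨key h.1, key h.2.1, key h.2.2⟩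

variable (O)

/-- `t` is a middle part of a geodesic from `1` to `α * t * β⁻¹`, with normalized endpoints. -/
def Middle (α t β : G) : Prop :=
  O.d 1 α + O.d 1 t + O.d 1 β = O.d 1 (α * t * β⁻¹) ∧
    (0 ≤ O.deg α ∧ O.deg α ≤ 2) ∧ 0 ≤ O.deg β ∧ O.deg β ≤ 2

open Classical in
/-- The values of `f` on products with a given middle part, as a kernel. -/
noncomputable def spread (f : G → ENNReal) (t α β : G) : ENNReal :=
  if O.Middle α t β then f (α * t * β⁻¹) else 0

/-- The Hilbert–Schmidt norm of `spread`. -/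
noncomputable def profile (f : G → ENNReal) (t : G) : ENNReal :=
  (∑' α, ∑' β, O.spread f t α β ^ 2) ^ (1 / 2 : ℝ)

variable {O}

lemma Middle.btw {α t β : G} (h : O.Middle α t β) :
    O.Btw 1 α (α * t * β⁻¹) ∧ O.Btw 1 β (α * t * β⁻¹)⁻¹ := by
  have h1 := h.1
  have e1 := O.d_mul_left α 1 t
  have e2 := O.d_mul_left (α * t) 1 β⁻¹
  have e3 := O.d_mul_left β 1 (t⁻¹ * α⁻¹)
  have e4 := O.d_mul_left t⁻¹ 1 α⁻¹
  have e5 : (α * t * β⁻¹)⁻¹ = β * (t⁻¹ * α⁻¹) := by group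
  rw [mul_one] at e1 e2 e3 e4
  have e6 := O.d_one_inv t
  have e7 := O.d_one_inv α
  have e8 := O.d_one_inv β
  have e9 := O.d_one_inv (α * t * β⁻¹)
  have t1 := O.rankThree.d_tri α (α * t) (α * t * β⁻¹)
  have t2 := O.rankThree.d_tri 1 α (α * t * β⁻¹)
  have t3 := O.rankThree.d_tri 1 t⁻¹ (t⁻¹ * α⁻¹)
  have t4 := O.rankThree.d_tri 1 β (β * (t⁻¹ * α⁻¹))
  rw [e5] at *
  simp only [Btw, RankThree.Btw, d] at *
  omega

lemma tsum_profile_sq_le {f : G → ENNReal} {n : ℕ} (hf : ∀ g, f g ≠ 0 → O.Ball n g) {K : ℕ}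
    (hK : 2 * n + 2 ≤ K) :
    ∑' t, O.profile f t ^ 2 ≤ (((3 * K + 1) ^ 3 : ℕ) : ENNReal) ^ 2 * ∑' g, f g ^ 2 := by
  classical
  set N : ENNReal := (((3 * K + 1) ^ 3 : ℕ) : ENNReal)
  set I : G → G → ENNReal := fun m v => if O.Btw 1 v m ∧ |O.deg v| ≤ K then 1 else 0 with hI
  calc ∑' t, O.profile f t ^ 2 = ∑' t, ∑' α, ∑' β, O.spread f t α β ^ 2 := by
        simp_rw [profile, ENNReal.rpow_half_sq]
    _ = ∑' α, ∑' β, ∑' t, O.spread f t α β ^ 2 := by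
        rw [ENNReal.tsum_comm]
        exact tsum_congr fun α => ENNReal.tsum_comm
    _ = ∑' α, ∑' β, ∑' g, O.spread f (α⁻¹ * g * β) α β ^ 2 := by
        refine tsum_congr fun α => tsum_congr fun β => ?_
        exact (((Equiv.mulLeft α⁻¹).trans (Equiv.mulRight β)).tsum_eq
          fun t => O.spread f t α β ^ 2).symm
    _ ≤ ∑' α, ∑' β, ∑' g, f g ^ 2 * (I g α * I g⁻¹ β) := by
        refine ENNReal.tsum_le_tsum fun α => ENNReal.tsum_le_tsum fun β =>
          ENNReal.tsum_le_tsum fun g => ?_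
        simp only [spread]
        split_ifs with h
        · have hb := h.btw
          have e : α * (α⁻¹ * g * β) * β⁻¹ = g := by group
          rw [e] at hb ⊢
          simp only [hI]
          have h2 := h.2
          rw [if_pos ⟨hb.1, by rw [abs_le]; omega⟩, if_pos ⟨hb.2, by rw [abs_le]; omega⟩, mul_one,
            mul_one]
        · simp
    _ = ∑' α, ∑' g, ∑' β, f g ^ 2 * (I g α * I g⁻¹ β) :=
        tsum_congr fun α => ENNReal.tsum_comm
    _ = ∑' g, ∑' α, ∑' β, f g ^ 2 * (I g α * I g⁻¹ β) := ENNReal.tsum_comm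
    _ = ∑' g, f g ^ 2 * ((∑' α, I g α) * ∑' β, I g⁻¹ β) := by
        simp_rw [ENNReal.tsum_mul_left, ENNReal.tsum_mul_right]
    _ ≤ ∑' g, f g ^ 2 * (N * N) := by
        refine ENNReal.tsum_le_tsum fun g => ?_
        by_cases h : f g = 0
        · simp [h]
        · have := (hf g h).d_le
          refine mul_le_mul_right (mul_le_mul' (O.tsum_btw_le ?_) (O.tsum_btw_le ?_)) _
          · omega
          · rw [O.d_one_inv]
            omega
    _ = _ := by rw [ENNReal.tsum_mul_right, sq, mul_comm]

lemma profile_ne_zero {f : G → ENNReal} {n : ℕ} (hf : ∀ g, f g ≠ 0 → O.Ball n g) {t : G}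
    (ht : O.profile f t ≠ 0) : O.d 1 t ≤ 2 * n ∧ |O.deg t| ≤ 3 * n + 2 := by
  obtain ⟨α, β, h⟩ : ∃ α β, O.spread f t α β ≠ 0 := by
    by_contra! h
    simp [profile, h] at ht
  simp only [spread] at h
  split_ifs at h with hm
  · have h1 := (hf _ h).d_le
    have h2 := (hf _ h).abs_deg_le
    have h3 := O.rankThree.d_nonneg 1 α
    have h4 := O.rankThree.d_nonneg 1 β
    obtain ⟨m1, m2, m3⟩ := hm
    rw [O.deg_mul, O.deg_mul, O.deg_inv, abs_le] at h2
    rw [abs_le]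
    simp only [d] at *
    omega
  · exact absurd rfl h

open Classical in
lemma tsum_mul_mul_le (f g η : G → ENNReal) :
    ∑' h, ∑' k, f h * g k * η (h * k) ≤
      ∑' s, ∑' t, if O.rankThree.MetricTriangle 1 s (s * t) then
        O.profile f s * O.profile g t * O.profile η (s * t) else 0 := by
  set Θ : G × G × G × G × G → ENNReal := fun p =>
    if O.rankThree.MetricTriangle 1 p.1 (p.1 * p.2.1) then
      O.spread f p.1 p.2.2.1 p.2.2.2.1 * O.spread g p.2.1 p.2.2.2.1 p.2.2.2.2 *
      O.spread η (p.1 * p.2.1) p.2.2.1 p.2.2.2.2 else 0 with hΘ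
  set e : G × G × G × G × G → G × G × G × G × G := fun p =>
    (p.2.2.1⁻¹ * p.1 * p.2.2.2.1, p.2.2.2.1⁻¹ * p.2.1 * p.2.2.2.2, p.2.2) with he
  have he_inj : Function.Injective e := by
    rintro ⟨h, k, α, β, γ⟩ ⟨h', k', α', β', γ'⟩ hh
    simp only [he, Prod.mk.injEq] at hh
    obtain ⟨h1, h2, rfl, rfl, rfl⟩ := hh
    rw [mul_left_cancel (mul_right_cancel h1), mul_left_cancel (mul_right_cancel h2)]
  have hterm : ∀ h k, f h * g k * η (h * k) ≤ ∑' α, ∑' β, ∑' γ, Θ (e (h, k, α, β, γ)) := by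
    intro h k
    obtain ⟨p₀, q₀, r₀, m1, m2, m3, m4⟩ := O.rankThree.exists_quasiMedian 1 h (h * k)
    obtain ⟨p, p1, p2, p3, p4⟩ := O.exists_normalized 1 p₀
    obtain ⟨q, q1, q2, q3, q4⟩ := O.exists_normalized h⁻¹ q₀
    obtain ⟨r, r1, r2, r3, r4⟩ := O.exists_normalized (h * k)⁻¹ r₀
    rw [one_mul] at p3 p4
    have hp : O.d p₀ p = 0 := by rw [p1]; exact O.rankThree.d_self _
    have hq : O.d q₀ q = 0 := by rw [q1]; exact O.rankThree.d_self _
    have hr : O.d r₀ r = 0 := by rw [r1]; exact O.rankThree.d_self _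
    have m5 := metricTriangle_congr hp m4
    have m6 := metricTriangle_congr hq m5.rotate
    have m7 := metricTriangle_mul_left p⁻¹ (metricTriangle_congr hr m6.rotate).rotate
    rw [inv_mul_cancel] at m7
    have n1 : O.d 1 p + O.d 1 (p⁻¹ * q) + O.d 1 (h⁻¹ * q) = O.d 1 h := by
      rw [← O.d_eq_one p, ← O.d_eq_one h, O.d_comm h q]
      have := p1 1
      have := p2 q
      have := q1 p₀
      have := q2 h
      simp only [d] at *
      omega
    have n2 : O.d 1 (h⁻¹ * q) + O.d 1 (q⁻¹ * r) + O.d 1 ((h * k)⁻¹ * r) = O.d 1 k := by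
      rw [← O.d_eq_one h, ← O.d_eq_one q, ← O.d_eq_one (h * k), O.d_comm (h * k) r]
      have := q1 h
      have := q2 r
      have := r1 q₀
      have := r2 (h * k)
      have := O.d_mul_left h 1 k
      rw [mul_one] at this
      simp only [d] at *
      omega
    have n3 : O.d 1 p + O.d 1 (p⁻¹ * r) + O.d 1 ((h * k)⁻¹ * r) = O.d 1 (h * k) := by
      rw [← O.d_eq_one p, ← O.d_eq_one (h * k), O.d_comm p r, O.d_comm 1 p,
        O.d_comm 1 (h * k)]
      have := r1 (h * k)
      have := r2 p
      have := p1 r₀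
      have := p2 1
      simp only [d] at *
      omega
    refine le_trans (le_of_eq ?_) ((ENNReal.le_tsum (f := fun γ =>
      Θ (e (h, k, p, h⁻¹ * q, γ))) ((h * k)⁻¹ * r)).trans ((ENNReal.le_tsum (f := fun β =>
      ∑' γ, Θ (e (h, k, p, β, γ))) (h⁻¹ * q)).trans (ENNReal.le_tsum p)))
    have e1 : p⁻¹ * h * (h⁻¹ * q) = p⁻¹ * q := by group
    have e2 : (h⁻¹ * q)⁻¹ * k * ((h * k)⁻¹ * r) = q⁻¹ * r := by group
    have e3 : p⁻¹ * q * (q⁻¹ * r) = p⁻¹ * r := by group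
    have e4 : p * (p⁻¹ * q) * (h⁻¹ * q)⁻¹ = h := by group
    have e5 : (h⁻¹ * q) * (q⁻¹ * r) * ((h * k)⁻¹ * r)⁻¹ = k := by group
    have e6 : p * (p⁻¹ * r) * ((h * k)⁻¹ * r)⁻¹ = h * k := by group
    simp only [hΘ, he, e1, e2, e3, if_pos m7, spread, Middle, e4, e5, e6, n1, n2, n3, p3, p4, q3,
      q4, r3, r4, and_self, if_true]
  calc ∑' h, ∑' k, f h * g k * η (h * k)
      ≤ ∑' h, ∑' k, ∑' α, ∑' β, ∑' γ, Θ (e (h, k, α, β, γ)) :=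
        ENNReal.tsum_le_tsum fun h => ENNReal.tsum_le_tsum fun k => hterm h k
    _ = ∑' p, Θ (e p) := by simp_rw [ENNReal.tsum_prod']
    _ ≤ ∑' p, Θ p := ENNReal.tsum_comp_le_tsum_of_injective he_inj _
    _ = ∑' s, ∑' t, ∑' α, ∑' β, ∑' γ, Θ (s, t, α, β, γ) := by simp_rw [ENNReal.tsum_prod']
    _ ≤ _ := by
      refine ENNReal.tsum_le_tsum fun s => ENNReal.tsum_le_tsum fun t => ?_
      by_cases hm : O.rankThree.MetricTriangle 1 s (s * t)
      · simp only [hΘ, if_pos hm]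
        refine ENNReal.le_of_sq_le_sq ((ENNReal.sq_tsum_kernel_le _ _ _).trans (le_of_eq ?_))
        simp_rw [mul_pow, profile, ENNReal.rpow_half_sq]
      · simp [hΘ, hm]

lemma sq_tsum_mul_mul_le {f g η : G → ENNReal} {n : ℕ} (hf : ∀ x, f x ≠ 0 → O.Ball n x)
    (hg : ∀ x, g x ≠ 0 → O.Ball n x) (hη : ∀ x, η x ≠ 0 → O.Ball n x) :
    (∑' h, ∑' k, f h * g k * η (h * k)) ^ 2 ≤
      ((12 * n + 13 : ℕ) : ENNReal) ^ 27 *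
        ((∑' x, f x ^ 2) * (∑' x, g x ^ 2) * ∑' x, η x ^ 2) := by
  have hb : ∀ {u : G → ENNReal}, (∀ x, u x ≠ 0 → O.Ball n x) → ∀ t, O.profile u t ≠ 0 →
      2 * O.d 1 t ≤ (4 * n + 4 : ℕ) ∧ |O.deg t| + 2 ≤ (4 * n + 4 : ℕ) := by
    intro u hu t ht
    have := profile_ne_zero hu ht
    push_cast
    omega
  have hs : ∀ {u : G → ENNReal}, (∀ x, u x ≠ 0 → O.Ball n x) →
      ∑' t, O.profile u t ^ 2 ≤
        (((3 * (4 * n + 4) + 1) ^ 3 : ℕ) : ENNReal) ^ 2 * ∑' g, u g ^ 2 :=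
    fun hu => tsum_profile_sq_le hu (by omega)
  refine (pow_le_pow_left₀ zero_le (tsum_mul_mul_le (O := O) f g η) 2).trans
    ((O.sq_tsum_metricTriangle_le (by omega) (hb hf) (hb hg)).trans ?_)
  refine (mul_le_mul' (mul_le_mul' (mul_le_mul_right (hs hf) _) (hs hg)) (hs hη)).trans
    (le_of_eq ?_)
  have : 3 * (4 * n + 4) + 1 = 12 * n + 13 := by ring
  rw [this]
  push_cast
  ring

end GarsideOrder

lemma l2norm_nonneg {G : Type*} (f : G →₀ ℂ) : 0 ≤ l2norm f := Real.sqrt_nonneg _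

lemma l2norm_sq {G : Type*} (f : G →₀ ℂ) : l2norm f ^ 2 = ∑ x ∈ f.support, ‖f x‖ ^ 2 :=
  Real.sq_sqrt (Finset.sum_nonneg fun _ _ => by positivity)

lemma tsum_enorm_sq {G : Type*} (f : G →₀ ℂ) : ∑' x, ‖f x‖ₑ ^ 2 = ENNReal.ofReal (l2norm f ^ 2) := by
  rw [l2norm_sq, ENNReal.ofReal_sum_of_nonneg (fun _ _ => by positivity),
    tsum_eq_sum (s := f.support)]
  · refine Finset.sum_congr rfl fun x _ => ?_
    rw [ENNReal.ofReal_pow (norm_nonneg _), ofReal_norm]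
  · intro x hx
    simp [Finsupp.notMem_support_iff.mp hx]

section Convolution

variable {G : Type*} [Group G]

lemma conv_apply (f g : G →₀ ℂ) (x : G) :
    conv f g x = f.sum fun y cy => cy * g (y⁻¹ * x) := by
  classical
  unfold conv
  rw [Finsupp.sum_apply]
  refine Finsupp.sum_congr fun y _ => ?_
  rw [Finsupp.sum_apply]
  simp only [Finsupp.single_apply]
  rw [Finsupp.sum, Finset.sum_eq_single (y⁻¹ * x)]
  · simp
  · intro z _ hz
    rw [if_neg]
    rintro rfl
    simp at hz
  · intro hz
    simp [Finsupp.notMem_support_iff.mp hz]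

lemma exists_mul_of_conv_ne_zero {f g : G →₀ ℂ} {x : G} (hx : conv f g x ≠ 0) :
    ∃ y, f y ≠ 0 ∧ g (y⁻¹ * x) ≠ 0 := by
  rw [conv_apply] at hx
  obtain ⟨y, -, hy⟩ := Finset.exists_ne_zero_of_sum_ne_zero hx
  exact ⟨y, left_ne_zero_of_mul hy, right_ne_zero_of_mul hy⟩

end Convolution

namespace GarsideOrder

variable {G : Type*} [Group G] {O : GarsideOrder G}

/-- All elements of the support of `f` lie in the ball of radius `n`. -/
def SupportedIn (O : GarsideOrder G) (n : ℤ) (f : G →₀ ℂ) : Prop := ∀ x, f x ≠ 0 → O.Ball n x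

lemma SupportedIn.mono {m n : ℤ} (hmn : m ≤ n) {f : G →₀ ℂ} (h : O.SupportedIn m f) :
    O.SupportedIn n f := fun x hx => (h x hx).mono hmn

lemma SupportedIn.conv {m n : ℤ} {f g : G →₀ ℂ} (hf : O.SupportedIn m f)
    (hg : O.SupportedIn n g) : O.SupportedIn (m + n) (conv f g) := by
  intro x hx
  obtain ⟨y, h1, h2⟩ := exists_mul_of_conv_ne_zero hx
  simpa using (hf y h1).mul (hg _ h2)

lemma exists_supportedIn (O : GarsideOrder G) (f : G →₀ ℂ) : ∃ n : ℕ, O.SupportedIn n f := by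
  obtain ⟨n, hn⟩ := O.exists_ball_finset f.support
  exact ⟨n, fun x hx => hn x (Finsupp.mem_support_iff.mpr hx)⟩

lemma tsum_enorm_conv_sq_le {n : ℕ} {f g : G →₀ ℂ} (hf : O.SupportedIn n f)
    (hg : O.SupportedIn n g) :
    ∑' x, ‖_root_.conv f g x‖ₑ ^ 2 ≤
      ((24 * n + 13 : ℕ) : ENNReal) ^ 27 * ((∑' x, ‖f x‖ₑ ^ 2) * ∑' x, ‖g x‖ₑ ^ 2) := by
  classical
  set η : G → ENNReal := fun x => ∑' y, ‖f y‖ₑ * ‖g (y⁻¹ * x)‖ₑ with hη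
  have hηsum : ∀ x, η x = ∑ y ∈ f.support, ‖f y‖ₑ * ‖g (y⁻¹ * x)‖ₑ := fun x =>
    tsum_eq_sum fun y hy => by simp [Finsupp.notMem_support_iff.mp hy]
  have hle : ∀ x, ‖_root_.conv f g x‖ₑ ≤ η x := by
    intro x
    rw [hηsum, conv_apply]
    refine (enorm_sum_le _ _).trans (Finset.sum_le_sum fun y _ => ?_)
    rw [enorm_mul]
  have hne : ∀ x, η x ≠ 0 → ∃ y, f y ≠ 0 ∧ g (y⁻¹ * x) ≠ 0 := by
    intro x hx
    rw [hηsum] at hx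
    obtain ⟨y, -, hy⟩ := Finset.exists_ne_zero_of_sum_ne_zero hx
    exact ⟨y, by simpa using left_ne_zero_of_mul hy, by simpa using right_ne_zero_of_mul hy⟩
  have hball : ∀ x, η x ≠ 0 → O.Ball (2 * n : ℕ) x := by
    intro x hx
    obtain ⟨y, h1, h2⟩ := hne x hx
    have := (hf y h1).mul (hg _ h2)
    rw [mul_inv_cancel_left] at this
    exact this.mono (by push_cast; omega)
  have hfin : ∑' x, η x ^ 2 ≠ ⊤ := by
    rw [tsum_eq_sum (s := Finset.image₂ (· * ·) f.support g.support)]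
    · refine (ENNReal.sum_lt_top.mpr fun x _ => ENNReal.pow_lt_top ?_).ne
      rw [hηsum]
      exact ENNReal.sum_lt_top.mpr fun y _ => ENNReal.mul_lt_top enorm_lt_top enorm_lt_top
    · intro x hx
      by_contra h
      obtain ⟨y, h1, h2⟩ := hne x (fun h0 => h (by simp [h0]))
      exact hx (Finset.mem_image₂.mpr ⟨y, Finsupp.mem_support_iff.mpr h1, _,
        Finsupp.mem_support_iff.mpr h2, mul_inv_cancel_left _ _⟩)
  have hexp : ∑' x, η x ^ 2 = ∑' h, ∑' k, ‖f h‖ₑ * ‖g k‖ₑ * η (h * k) := by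
    calc ∑' x, η x ^ 2 = ∑' x, ∑' h, ‖f h‖ₑ * ‖g (h⁻¹ * x)‖ₑ * η x := by
          refine tsum_congr fun x => ?_
          rw [sq, ENNReal.tsum_mul_right]
      _ = ∑' h, ∑' x, ‖f h‖ₑ * ‖g (h⁻¹ * x)‖ₑ * η x := ENNReal.tsum_comm
      _ = _ := by
          refine tsum_congr fun h => ?_
          rw [← (Equiv.mulLeft h).tsum_eq]
          simp
  have key := sq_tsum_mul_mul_le (O := O) (f := fun x => ‖f x‖ₑ) (g := fun x => ‖g x‖ₑ) (η := η)
    (n := 2 * n) (fun x hx => (hf x (by simpa using hx)).mono (by push_cast; omega))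
    (fun x hx => (hg x (by simpa using hx)).mono (by push_cast; omega)) hball
  rw [← hexp, sq, ← mul_assoc, ← mul_assoc 12 2 n] at key
  refine (ENNReal.tsum_le_tsum fun x => pow_le_pow_left' (hle x) 2).trans ?_
  by_cases h0 : ∑' x, η x ^ 2 = 0
  · rw [h0]; exact zero_le
  · exact (ENNReal.mul_le_mul_iff_left h0 hfin).mp key

/-- The factor in the rapid decay inequality for balls of radius `n`. -/
noncomputable def decay (n : ℕ) : ℝ := (37 * (n + 1)) ^ 14

lemma decay_pos (n : ℕ) : 0 < decay n := by unfold decay; positivity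

lemma decay_two_pow_mul_le (j n : ℕ) : decay (2 ^ j * n) ≤ (2 ^ 14) ^ j * decay n := by
  have h : (1 : ℝ) ≤ 2 ^ j := one_le_pow₀ (by norm_num)
  calc decay (2 ^ j * n) ≤ (2 ^ j * (37 * (n + 1))) ^ 14 := by
        unfold decay
        push_cast
        refine pow_le_pow_left₀ (by positivity) ?_ _
        nlinarith
    _ = (2 ^ 14) ^ j * decay n := by unfold decay; rw [mul_pow, ← pow_mul, ← pow_mul, mul_comm j]

lemma l2norm_conv_le {n : ℕ} {f g : G →₀ ℂ} (hf : O.SupportedIn n f) (hg : O.SupportedIn n g) :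
    l2norm (_root_.conv f g) ≤ decay n * l2norm f * l2norm g := by
  have hf0 := l2norm_nonneg f
  have hg0 := l2norm_nonneg g
  have hd := decay_pos n
  have h := tsum_enorm_conv_sq_le hf hg
  rw [tsum_enorm_sq, tsum_enorm_sq, tsum_enorm_sq, ← ENNReal.ofReal_natCast,
    ← ENNReal.ofReal_pow (by positivity), ← ENNReal.ofReal_mul (by positivity),
    ← ENNReal.ofReal_mul (by positivity), ENNReal.ofReal_le_ofReal_iff (by positivity)] at h
  refine le_of_sq_le_sq ?_ (by positivity)
  refine h.trans ?_
  have h1 : (((24 * n + 13 : ℕ) : ℝ)) ^ 27 ≤ decay n ^ 2 := by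
    unfold decay
    rw [← pow_mul]
    push_cast
    have hn : (0 : ℝ) ≤ n := Nat.cast_nonneg n
    calc (24 * (n : ℝ) + 13) ^ 27 ≤ (24 * (n : ℝ) + 13) ^ 28 :=
          pow_le_pow_right₀ (by linarith) (by norm_num)
      _ ≤ (37 * ((n : ℝ) + 1)) ^ 28 := pow_le_pow_left₀ (by positivity) (by linarith) _
  calc _ ≤ decay n ^ 2 * (l2norm f ^ 2 * l2norm g ^ 2) := by gcongr
    _ = _ := by ring

end GarsideOrder

section ConvolutionOperators

variable {G : Type*}

/-- A finitely supported function as an element of `ℓ²`. -/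
noncomputable def toLp (u : G →₀ ℂ) : lp (fun _ : G => ℂ) 2 :=
  ⟨fun x => u x, memℓp_gen (summable_of_hasFiniteSupport (u.hasFiniteSupport.subset fun x hx => by
    contrapose! hx
    simp_all))⟩

@[simp] lemma toLp_apply (u : G →₀ ℂ) (x : G) : toLp u x = u x := rfl

lemma norm_toLp (u : G →₀ ℂ) : ‖toLp u‖ = l2norm u := by
  have h := lp.norm_rpow_eq_tsum (p := 2) (by norm_num) (toLp u)
  simp only [ENNReal.toReal_ofNat, Real.rpow_ofNat, toLp_apply] at h
  rw [tsum_eq_sum (s := u.support)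
    (fun x hx => by simp [Finsupp.notMem_support_iff.mp hx]), ← l2norm_sq] at h
  exact (sq_eq_sq₀ (norm_nonneg _) (l2norm_nonneg u)).mp h

lemma denseRange_toLp : DenseRange (toLp (G := G)) := by
  classical
  intro ξ
  refine mem_closure_of_tendsto (lp.hasSum_single (by norm_num) ξ)
    (Filter.Eventually.of_forall fun s => ⟨∑ i ∈ s, Finsupp.single i (ξ i), ?_⟩)
  ext x
  rw [toLp_apply, Finsupp.finsetSum_apply, lp.coeFn_sum, Finset.sum_apply]
  refine Finset.sum_congr rfl fun i _ => ?_
  rw [Finsupp.single_apply, lp.single_apply, Pi.single_apply]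
  simp only [eq_comm]

variable [Group G]

/-- `T` is the operator of left convolution by `f`. -/
def IsConvOp (T : lp (fun _ : G => ℂ) 2 →L[ℂ] lp (fun _ : G => ℂ) 2) (f : G →₀ ℂ) : Prop :=
  ∀ (ξ : lp (fun _ : G => ℂ) 2) (g : G), T ξ g = f.sum fun h ch => ch * ξ (h⁻¹ * g)

/-- The involution `f*(x) = conj (f x⁻¹)`. -/
noncomputable def involution (f : G →₀ ℂ) : G →₀ ℂ :=
  (f.mapRange (starRingEnd ℂ) (map_zero _)).mapDomain (·⁻¹)

lemma involution_apply (f : G →₀ ℂ) (x : G) : involution f x = starRingEnd ℂ (f x⁻¹) := by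
  have := Finsupp.mapDomain_apply inv_injective (f.mapRange (starRingEnd ℂ) (map_zero _)) x⁻¹
  rw [inv_inv] at this
  exact this

lemma sum_involution (f : G →₀ ℂ) {M : Type*} [AddCommMonoid M] (F : G → ℂ → M)
    (hF : ∀ x, F x 0 = 0) :
    (involution f).sum F = f.sum fun x c => F x⁻¹ (starRingEnd ℂ c) := by
  unfold involution
  rw [Finsupp.sum_mapDomain_index_inj inv_injective, Finsupp.sum_mapRange_index fun x => hF _]

lemma l2norm_involution (f : G →₀ ℂ) : l2norm (involution f) = l2norm f := by
  unfold l2norm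
  rw [sum_involution _ _ (by simp)]
  simp

lemma conv_one (f : G →₀ ℂ) : conv f (Finsupp.single 1 1) = f := by
  unfold conv
  simp only [Finsupp.sum_single_index, mul_zero, Finsupp.single_zero, mul_one, Finsupp.sum_single]

namespace IsConvOp

variable {S T : lp (fun _ : G => ℂ) 2 →L[ℂ] lp (fun _ : G => ℂ) 2} {f g : G →₀ ℂ}

lemma mul (hT : IsConvOp T f) (hS : IsConvOp S g) : IsConvOp (T * S) (conv f g) := by
  intro ξ x
  rw [mul_apply_eq_comp, hT]
  unfold conv
  rw [Finsupp.sum_sum_index (by simp) (by intros; ring)]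
  refine Finsupp.sum_congr fun y _ => ?_
  rw [Finsupp.sum_sum_index (by simp) (by intros; ring), hS, Finsupp.mul_sum]
  refine Finsupp.sum_congr fun z _ => ?_
  rw [Finsupp.sum_single_index (by simp)]
  simp only [mul_inv_rev, mul_assoc]

lemma one : IsConvOp (1 : lp (fun _ : G => ℂ) 2 →L[ℂ] lp (fun _ : G => ℂ) 2)
    (Finsupp.single 1 1) := by
  intro ξ x
  rw [Finsupp.sum_single_index (by simp)]
  simp

lemma pow (hT : IsConvOp T f) (n : ℕ) : IsConvOp (T ^ n) (convPow f n) := by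
  induction n with
  | zero => exact one
  | succ n ih => rw [pow_succ]; exact ih.mul hT

lemma apply_toLp (hT : IsConvOp T f) (u : G →₀ ℂ) : T (toLp u) = toLp (conv f u) := by
  ext x
  rw [hT, toLp_apply, conv_apply]
  rfl

lemma l2norm_le (hT : IsConvOp T f) : l2norm f ≤ ‖T‖ := by
  have h := T.le_opNorm (toLp (Finsupp.single 1 1))
  rw [hT.apply_toLp, conv_one, norm_toLp, norm_toLp] at h
  simpa [l2norm] using h

lemma adjoint (hT : IsConvOp T f) : IsConvOp (ContinuousLinearMap.adjoint T) (involution f) := by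
  classical
  intro ξ x
  have key : T (lp.single 2 x 1) = ∑ h ∈ f.support, f h • lp.single 2 (h * x) (1 : ℂ) := by
    ext y
    rw [hT, lp.coeFn_sum, Finset.sum_apply]
    refine Finset.sum_congr rfl fun h _ => ?_
    rw [lp.coeFn_smul, Pi.smul_apply, smul_eq_mul]
    simp only [lp.coeFn_single, Pi.single_apply, inv_mul_eq_iff_eq_mul]
  have h1 : ContinuousLinearMap.adjoint T ξ x
      = inner ℂ (lp.single 2 x (1 : ℂ)) (ContinuousLinearMap.adjoint T ξ) := by
    rw [lp.inner_single_left]; simp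
  rw [h1, ContinuousLinearMap.adjoint_inner_right, key, sum_inner,
    sum_involution _ _ (by simp)]
  refine Finset.sum_congr rfl fun h _ => ?_
  rw [inner_smul_left, lp.inner_single_left]
  simp

end IsConvOp

end ConvolutionOperators

namespace GarsideOrder

variable {G : Type*} [Group G] {O : GarsideOrder G}
  {S T : lp (fun _ : G => ℂ) 2 →L[ℂ] lp (fun _ : G => ℂ) 2} {f : G →₀ ℂ}

lemma SupportedIn.involution {n : ℤ} (hf : O.SupportedIn n f) :
    O.SupportedIn n (involution f) := by
  intro x hx
  rw [involution_apply] at hx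
  simpa using (hf x⁻¹ (by simpa using hx)).inv

lemma SupportedIn.convPow {L : ℕ} (hf : O.SupportedIn L f) (n : ℕ) :
    O.SupportedIn (n * L : ℕ) (convPow f n) := by
  induction n with
  | zero =>
    intro x hx
    obtain ⟨rfl, -⟩ := (Finsupp.single_apply_ne_zero (b := (1 : ℂ))).mp hx
    simpa using O.ball_one
  | succ n ih =>
    have := ih.conv hf
    rw [_root_.convPow]
    simpa [add_mul] using this

lemma exists_isConvOp_two_pow {L : ℕ} (hS : IsConvOp S f) (hf : O.SupportedIn L f) (j : ℕ) :
    ∃ g : G →₀ ℂ, IsConvOp (S ^ 2 ^ j) g ∧ O.SupportedIn (2 ^ j * L : ℕ) g ∧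
      decay L * (2 ^ 14) ^ (j + 1) * l2norm g ≤ (decay L * 2 ^ 14 * l2norm f) ^ 2 ^ j := by
  induction j with
  | zero => exact ⟨f, by simpa using hS, by simpa using hf, by simp⟩
  | succ j ih =>
    obtain ⟨g, h1, h2, h3⟩ := ih
    refine ⟨conv g g, ?_, ?_, ?_⟩
    · rw [pow_succ, pow_mul, sq]
      exact h1.mul h1
    · refine (h2.conv h2).mono (by push_cast; rw [pow_succ]; linarith)
    · have hd := decay_pos L
      have hg := l2norm_nonneg g
      calc decay L * (2 ^ 14) ^ (j + 1 + 1) * l2norm (conv g g)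
          ≤ decay L * (2 ^ 14) ^ (j + 1 + 1) * (((2 ^ 14) ^ j * decay L) * l2norm g * l2norm g) := by
            have := decay_two_pow_mul_le j L
            gcongr
            exact (l2norm_conv_le h2 h2).trans (by gcongr)
        _ = (decay L * (2 ^ 14) ^ (j + 1) * l2norm g) ^ 2 := by
            rw [pow_succ _ (j + 1), pow_succ _ j]; ring
        _ ≤ ((decay L * 2 ^ 14 * l2norm f) ^ 2 ^ j) ^ 2 := by gcongr
        _ = _ := by rw [← pow_mul, ← pow_succ]

lemma norm_apply_le_of_two_pow {E : Type*} [NormedAddCommGroup E] [InnerProductSpace ℂ E]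
    [CompleteSpace E] {S : E →L[ℂ] E} (hS : IsSelfAdjoint S) {v : ℝ} (hv : 0 ≤ v) (ξ : E) (j : ℕ)
    (h : ‖(S ^ 2 ^ j) ξ‖ ≤ v ^ 2 ^ j * ‖ξ‖) : ‖S ξ‖ ≤ v * ‖ξ‖ := by
  induction j with
  | zero => simpa using h
  | succ j ih =>
    refine ih (le_of_sq_le_sq ?_ (by positivity))
    have hA : IsSelfAdjoint (S ^ 2 ^ j) := hS.pow _
    have h1 : inner ℂ ((S ^ 2 ^ j) ξ) ((S ^ 2 ^ j) ξ) = inner ℂ ξ ((S ^ 2 ^ (j + 1)) ξ) := by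
      rw [pow_succ 2 j, pow_mul, sq, mul_apply_eq_comp]
      exact ContinuousLinearMap.isSelfAdjoint_iff_isSymmetric.mp hA ξ _
    calc ‖(S ^ 2 ^ j) ξ‖ ^ 2 = ‖inner ℂ ξ ((S ^ 2 ^ (j + 1)) ξ)‖ := by
          rw [← h1, inner_self_eq_norm_sq_to_K]; simp
      _ ≤ ‖ξ‖ * ‖(S ^ 2 ^ (j + 1)) ξ‖ := norm_inner_le_norm _ _
      _ ≤ ‖ξ‖ * (v ^ 2 ^ (j + 1) * ‖ξ‖) := by gcongr
      _ = (v ^ 2 ^ j * ‖ξ‖) ^ 2 := by rw [pow_succ 2 j, pow_mul]; ring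

lemma norm_le_of_isSelfAdjoint {L : ℕ} (hL : 1 ≤ L) (hS : IsConvOp S f) (hsa : IsSelfAdjoint S)
    (hf : O.SupportedIn L f) : ‖S‖ ≤ decay L * 2 ^ 14 * l2norm f := by
  have hd := decay_pos L
  have hf0 := l2norm_nonneg f
  refine S.opNorm_le_bound (by positivity) fun ξ => ?_
  refine denseRange_toLp.induction_on (p := fun ξ => ‖S ξ‖ ≤ decay L * 2 ^ 14 * l2norm f * ‖ξ‖)
    ξ (isClosed_le (by fun_prop) (by fun_prop)) fun u => ?_
  obtain ⟨m, hm⟩ := O.exists_supportedIn u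
  have hmL : m ≤ 2 ^ m * L := m.lt_two_pow_self.le.trans (Nat.le_mul_of_pos_right _ hL)
  obtain ⟨g, h1, h2, h3⟩ := exists_isConvOp_two_pow hS hf m
  refine norm_apply_le_of_two_pow hsa (by positivity) _ m ?_
  have hg := l2norm_nonneg g
  have hu := l2norm_nonneg u
  rw [h1.apply_toLp, norm_toLp, norm_toLp]
  calc l2norm (conv g u) ≤ decay (2 ^ m * L) * l2norm g * l2norm u :=
        l2norm_conv_le h2 (hm.mono (by exact_mod_cast hmL))
    _ ≤ (decay L * (2 ^ 14) ^ (m + 1) * l2norm g) * l2norm u := by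
        gcongr
        refine (decay_two_pow_mul_le m L).trans ?_
        rw [mul_comm]
        gcongr
        · norm_num
        · omega
    _ ≤ _ := by gcongr

lemma norm_le {L : ℕ} (hL : 1 ≤ L) (hT : IsConvOp T f) (hf : O.SupportedIn L f) :
    ‖T‖ ≤ 2 ^ 7 * decay (2 * L) * l2norm f := by
  have hd := decay_pos (2 * L)
  have hf0 := l2norm_nonneg f
  refine le_of_sq_le_sq ?_ (by positivity)
  have h := norm_le_of_isSelfAdjoint (L := 2 * L) (by omega) (hT.adjoint.mul hT)
    (by rw [← ContinuousLinearMap.star_eq_adjoint]; exact IsSelfAdjoint.star_mul_self T)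
    ((hf.involution.conv hf).mono (by push_cast; linarith))
  rw [ContinuousLinearMap.mul_def, ContinuousLinearMap.norm_adjoint_comp_self, ← sq] at h
  refine h.trans ?_
  have h2 : l2norm (conv (involution f) f) ≤ decay (2 * L) * l2norm f * l2norm f := by
    simpa [l2norm_involution] using l2norm_conv_le (n := 2 * L)
      (hf.involution.mono (by push_cast; linarith)) (hf.mono (by push_cast; linarith))
  calc _ ≤ decay (2 * L) * 2 ^ 14 * (decay (2 * L) * l2norm f * l2norm f) := by gcongr
    _ = _ := by ring

end GarsideOrder

lemma tendsto_const_mul_pow_rpow_one_div (M : ℝ) (hM : 0 < M) (D : ℕ) :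
    Filter.Tendsto (fun n : ℕ => (M * ((n : ℝ) + 1) ^ D) ^ (1 / (n : ℝ))) Filter.atTop (nhds 1) := by
  have h0 : Filter.Tendsto (fun n : ℕ => 1 / (n : ℝ)) Filter.atTop (nhds 0) :=
    tendsto_one_div_atTop_nhds_zero_nat
  have h1 : Filter.Tendsto (fun n : ℕ => M ^ (1 / (n : ℝ))) Filter.atTop (nhds 1) := by
    simpa using (tendsto_const_nhds (x := M)).rpow h0 (Or.inl hM.ne')
  have h2 : Filter.Tendsto (fun n : ℕ => ((n : ℝ) + 1) ^ (1 / (n : ℝ))) Filter.atTop (nhds 1) := by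
    have := (tendsto_rpow_div_mul_add 1 1 (-1) (by norm_num)).comp
      (Filter.tendsto_atTop_add_const_right _ (1 : ℝ) tendsto_natCast_atTop_atTop)
    refine this.congr fun n => ?_
    simp
  have h3 := h1.mul (h2.pow D)
  rw [one_pow, mul_one] at h3
  refine h3.congr fun n => ?_
  rw [Real.mul_rpow hM.le (by positivity), ← Real.rpow_natCast, ← Real.rpow_natCast,
    ← Real.rpow_mul (by positivity), ← Real.rpow_mul (by positivity), mul_comm (D : ℝ)]

namespace GarsideOrder

/-- Groups with a rank three Garside order have the `ℓ²` spectral radius property. -/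
theorem tendsto_l2norm_convPow {G : Type*} [Group G] (O : GarsideOrder G) {f : G →₀ ℂ}
    {T : lp (fun _ : G => ℂ) 2 →L[ℂ] lp (fun _ : G => ℂ) 2} (hT : IsConvOp T f) :
    Filter.Tendsto (fun n : ℕ => l2norm (convPow f n) ^ (1 / (n : ℝ)))
      Filter.atTop (nhds (spectralRadius ℂ T).toReal) := by
  obtain ⟨L, hL⟩ := O.exists_supportedIn f
  have hgelfand : Filter.Tendsto (fun n : ℕ => ‖T ^ n‖ ^ (1 / (n : ℝ))) Filter.atTop
      (nhds (spectralRadius ℂ T).toReal) := by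
    have hne : spectralRadius ℂ T ≠ ⊤ := by
      refine (lt_of_le_of_lt (spectrum.spectralRadius_le_pow_nnnorm_pow_one_div ℂ T 0) ?_).ne
      simp [ENNReal.mul_lt_top]
    refine ((ENNReal.tendsto_toReal hne).comp
      (spectrum.pow_norm_pow_one_div_tendsto_nhds_spectralRadius T)).congr fun n => ?_
    exact ENNReal.toReal_ofReal (by positivity)
  set M : ℝ := 2 ^ 7 * (37 * (2 * L + 3)) ^ 14 with hM
  have hM0 : 0 < M := by positivity
  have hupper : ∀ n : ℕ, l2norm (convPow f n) ≤ ‖T ^ n‖ := fun n => (hT.pow n).l2norm_le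
  have hlower : ∀ n : ℕ, ‖T ^ n‖ ≤ (M * ((n : ℝ) + 1) ^ 14) * l2norm (convPow f n) := by
    intro n
    have h := norm_le (L := n * L + 1) (by omega) (hT.pow n)
      ((hL.convPow n).mono (by push_cast; omega))
    refine h.trans (mul_le_mul_of_nonneg_right ?_ (l2norm_nonneg _))
    unfold decay
    rw [hM, mul_assoc, ← mul_pow]
    refine mul_le_mul_of_nonneg_left (pow_le_pow_left₀ (by positivity) ?_ _) (by positivity)
    push_cast
    have : (0 : ℝ) ≤ n := Nat.cast_nonneg n
    have : (0 : ℝ) ≤ L := Nat.cast_nonneg L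
    nlinarith
  have hpoly := tendsto_const_mul_pow_rpow_one_div M hM0 14
  have hquot := hgelfand.div hpoly one_ne_zero
  rw [div_one] at hquot
  refine tendsto_of_tendsto_of_tendsto_of_le_of_le hquot hgelfand (fun n => ?_) (fun n => ?_)
  · rw [Pi.div_apply, div_le_iff₀ (by positivity), mul_comm,
      ← Real.mul_rpow (by positivity) (l2norm_nonneg _)]
    exact Real.rpow_le_rpow (norm_nonneg _) (hlower n) (by positivity)
  · exact Real.rpow_le_rpow (l2norm_nonneg _) (hupper n) (by positivity)

end GarsideOrder

/-- The simple elements of the dual Garside structure of `B₄`, that is, the noncrossing partitions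
of a square: `0` is the identity, `1, …, 6` are the atoms `(12), (23), (34), (13), (24), (14)`,
`7, …, 12` are the elements of length two, and `13` is the Garside element `abc`. -/
abbrev Simple := Fin 14

namespace Simple

/-- The left-weighted normal form of the product of two simple elements `s` and `t` is
`(head s t) (tail s t)`. The hexadecimal digit of this numeral in position
`14 s + t` is `head s t`. -/
def head (s t : Simple) : Simple :=
  Fin.ofNat 14 (88179715604083359331538572152525496377123210245627756831531054637618757953914875060403159168989977079637438472841650990174541282682128121960613288599017393309510712926670801767382827664847488088455139238865777490243281764980691714716176 >>>
    (4 * (14 * s.val + t.val)) % 16)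

/-- The hexadecimal digit of this numeral in position `14 s + t` is `tail s t`. -/
def tail (s t : Simple) : Simple :=
  Fin.ofNat 14 (87727511934318830430737737384896208970605080237983814456285279284989845238812294032445779277237750073382015810551005679707396850646047017733326616147424914746179964578476681207163771461757152298470515403724947649290957413734245474500608 >>>
    (4 * (14 * s.val + t.val)) % 16)

/-- Left divisibility of simple elements. -/
def Dvd (s t : Simple) : Prop := ∃ r, tail s r = 0 ∧ head s r = t

instance (s t : Simple) : Decidable (Dvd s t) := by unfold Dvd; infer_instance

lemma head_tail_of_mul : ∀ s t x, tail s t = 0 → tail (tail s (head t x)) (tail t x) = 0 ∧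
    head (head s t) x = head s (head t x) ∧
    tail (head s t) x = head (tail s (head t x)) (tail t x) := by
  decide +kernel

lemma normal_head_head : ∀ s x y, head x y = x → tail x y = y →
    head (head s x) (head (tail s x) y) = head s x ∧
    tail (head s x) (head (tail s x) y) = head (tail s x) y := by
  decide +kernel

lemma tail_delta : ∀ x, tail 13 x = x := by decide +kernel

lemma tail_zero_right : ∀ s, tail s 0 = 0 := by decide +kernel

lemma head_zero_left : ∀ s, head 0 s = s := by decide +kernel

lemma tail_zero_left : ∀ s, tail 0 s = 0 := by decide +kernel

/-- Conjugation by `δ`, so that `s * δ = δ * s.conj`. -/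
def conj (s : Simple) : Simple := tail s 13

lemma head_delta_right : ∀ s, head s 13 = 13 := by decide +kernel

lemma conj_conj_conj_conj : ∀ s, conj (conj (conj (conj s))) = s := by decide +kernel

lemma exists_left_compl : ∀ s, ∃ t, tail t s = 0 ∧ head t s = 13 := by decide +kernel

lemma exists_mul_head : ∀ s x, ∃ r, tail s r = 0 ∧ head s r = head s x ∧
    tail r (tail s x) = 0 ∧ head r (tail s x) = x := by
  decide +kernel

lemma exists_lcm : ∀ s t, ∃ u, Dvd s u ∧ Dvd t u ∧ ∀ h, Dvd s h → Dvd t h → Dvd u h := by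
  decide +kernel

lemma mul_cases : ∀ s t, tail s t = 0 →
    s = 0 ∧ head s t = t ∨ t = 0 ∧ head s t = s ∨ (s, t, head s t) ∈
    ([(1, 2, 7), (1, 3, 11), (1, 5, 9), (1, 8, 13), (2, 3, 8), (2, 4, 7), (2, 6, 12), (2, 10, 13),
      (3, 1, 11), (3, 5, 8), (3, 6, 10), (3, 9, 13), (4, 1, 7), (4, 3, 10), (4, 11, 13), (5, 2, 8),
      (5, 6, 9), (5, 12, 13), (6, 1, 9), (6, 2, 12), (6, 4, 10), (6, 7, 13), (7, 3, 13), (8, 6, 13),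
      (9, 2, 13), (10, 1, 13), (11, 5, 13), (12, 4, 13)] : List (Simple × Simple × Simple)) := by
  decide +kernel

section Eval

variable {G : Type*} [Group G]

/-- The interpretation of simple elements by words in the standard generators. -/
def eval (a b c : G) : Simple → G :=
  ![1, a, b, c, a * b * a⁻¹, b * c * b⁻¹, a * (b * c * b⁻¹) * a⁻¹, a * b, b * c,
    a * (b * c * b⁻¹), a * b * a⁻¹ * c, a * c, b * (a * (b * c * b⁻¹) * a⁻¹), a * b * c]

lemma eval_mul {a b c : G} (h₁ : a * b * a = b * a * b) (h₂ : b * c * b = c * b * c)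
    (h₃ : a * c = c * a) {s t : Simple} (hst : tail s t = 0) :
    eval a b c s * eval a b c t = eval a b c (head s t) := by
  obtain ⟨x, hx⟩ : ∃ x, x = a * b * a⁻¹ := ⟨_, rfl⟩
  obtain ⟨y, hy⟩ : ∃ y, y = b * c * b⁻¹ := ⟨_, rfl⟩
  obtain ⟨z, hz⟩ : ∃ z, z = a * y * a⁻¹ := ⟨_, rfl⟩
  have e1 : x * a = a * b := by rw [hx]; group
  have e2 : b * x = a * b := by
    rw [hx, ← mul_assoc, ← mul_assoc, ← h₁]; group
  have e3 : y * b = b * c := by rw [hy]; group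
  have e4 : c * y = b * c := by
    rw [hy, ← mul_assoc, ← mul_assoc, ← h₂]; group
  have e5 : z * a = a * y := by rw [hz]; group
  have hy' : y = c⁻¹ * (b * c) := by rw [← e4]; group
  have hac : a * c⁻¹ = c⁻¹ * a := by rw [eq_inv_mul_iff_mul_eq, ← mul_assoc, ← h₃]; group
  have hca : c * a⁻¹ = a⁻¹ * c := by rw [eq_inv_mul_iff_mul_eq, ← mul_assoc, h₃]; group
  have e6 : y * z = a * y := by
    have : y * a * y = a * y * a := by
      calc y * a * y = c⁻¹ * (b * c) * a * (b * c * b⁻¹) := by rw [← hy', hy]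
        _ = c⁻¹ * b * (c * a) * b * c * b⁻¹ := by group
        _ = c⁻¹ * (b * a) * (c * b * c) * b⁻¹ := by rw [← h₃]; group
        _ = c⁻¹ * (b * a * b) * c := by rw [← h₂]; group
        _ = c⁻¹ * a * (b * (a * c)) := by rw [← h₁]; group
        _ = (a * c⁻¹) * (b * c * a) := by rw [h₃, hac]; group
        _ = a * (c⁻¹ * (b * c)) * a := by group
        _ = a * y * a := by rw [← hy']
    rw [hz, ← mul_assoc, ← mul_assoc, this]; group
  have e7 : c * z = x * c := by
    calc c * z = (c * a) * y * a⁻¹ := by rw [hz]; group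
      _ = a * (c * y) * a⁻¹ := by rw [← h₃]; group
      _ = a * b * (c * a⁻¹) := by rw [e4]; group
      _ = x * c := by rw [hca, hx]; group
  have e8 : z * x = x * c := by
    calc z * x = a * (y * b) * a⁻¹ := by rw [hz, hx]; group
      _ = a * b * (c * a⁻¹) := by rw [e3]; group
      _ = x * c := by rw [hca, hx]; group
  have e9 : z * b = b * z := by
    have h : a⁻¹ * b = b * (a * (b⁻¹ * a⁻¹)) := by
      rw [inv_mul_eq_iff_eq_mul]
      calc b = (b * a * b) * b⁻¹ * a⁻¹ := by group
        _ = _ := by rw [← h₁]; group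
    calc z * b = a * b * c * b⁻¹ * (a⁻¹ * b) := by rw [hz, hy]; group
      _ = a * b * (c * a) * (b⁻¹ * a⁻¹) := by rw [h]; group
      _ = (a * b * a) * c * (b⁻¹ * a⁻¹) := by rw [← h₃]; group
      _ = b * z := by rw [h₁, hz, hy]; group
  have hδ1 : a * b * c = x * c * a := by rw [← e1, mul_assoc, h₃, mul_assoc]
  have hδ2 : a * b * c = b * z * x := by rw [← e2, mul_assoc, mul_assoc, e8]
  have key := mul_cases s t hst
  rcases key with ⟨rfl, h⟩ | ⟨rfl, h⟩ | h
  · rw [h]; exact one_mul _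
  · rw [h]; exact mul_one _
  simp only [List.mem_cons, Prod.mk.injEq, List.not_mem_nil, or_false] at h
  have a1 : a * (b * c) = a * b * c := (mul_assoc _ _ _).symm
  have a2 : b * (x * c) = a * b * c := by rw [← e2, mul_assoc]
  have a3 : c * (a * y) = a * b * c := by rw [← mul_assoc, ← h₃, mul_assoc, e4, a1]
  have a4 : x * (a * c) = a * b * c := by rw [← e1, mul_assoc]
  have a5 : y * (b * z) = a * b * c := by rw [← e9, ← mul_assoc, e6, mul_assoc, e3, a1]
  have a6 : z * (a * b) = a * b * c := by rw [← mul_assoc, e5, mul_assoc, e3, a1]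
  have a7 : b * c * z = a * b * c := by rw [mul_assoc, e7, a2]
  have a8 : a * y * b = a * b * c := by rw [mul_assoc, e3, a1]
  have a9 : a * c * y = a * b * c := by rw [mul_assoc, e4, a1]
  subst hz hy hx
  rcases h with h | h | h | h | h | h | h | h | h | h | h | h | h | h | h | h | h | h | h | h | h |
    h | h | h | h | h | h | h <;> obtain ⟨rfl, rfl, h⟩ := h <;> rw [h]
  · rfl
  · rfl
  · rfl
  · exact a1
  · rfl
  · exact e2
  · rfl
  · exact a2
  · exact h₃.symm
  · exact e4
  · exact e7
  · exact a3
  · exact e1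
  · rfl
  · exact a4
  · exact e3
  · exact e6
  · exact a5
  · exact e5
  · exact e9
  · exact e8
  · exact a6
  · rfl
  · exact a7
  · exact a8
  · exact hδ1.symm
  · exact a9
  · exact hδ2.symm

end Eval

end Simple

/-- The powers of a central element form an Ore set. -/
@[reducible] def oreSetPowersOfCentral {R : Type*} [Monoid R] (z : R) (hz : ∀ r, z * r = r * z) :
    OreLocalization.OreSet (Submonoid.powers z) where
  ore_right_cancel r₁ r₂ s h := by
    obtain ⟨_, n, rfl⟩ := s
    refine ⟨⟨z ^ n, n, rfl⟩, ?_⟩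
    have hc : ∀ r, z ^ n * r = r * z ^ n := fun r => (Commute.pow_left (hz r) n).eq
    simpa only [hc] using h
  oreNum r _ := r
  oreDenom _ s := s
  ore_eq r s := by
    obtain ⟨_, n, rfl⟩ := s
    exact (Commute.pow_left (hz r) n).eq

lemma exists_localization_centralizer.{u} {M : Type u} [Monoid M] (z : M) :
    ∃ (H : Type u) (_ : Monoid H) (φ : Submonoid.centralizer {z} →* H),
      (∀ r : Submonoid.centralizer {z}, (r : M) = z → IsUnit (φ r)) ∧
      ∀ r s, φ r = φ s → ∃ n : ℕ, z ^ n * r = z ^ n * s := by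
  let z' : Submonoid.centralizer {z} := ⟨z, by simp [Submonoid.mem_centralizer_iff]⟩
  let _ := oreSetPowersOfCentral z'
    (fun r => Subtype.ext (Submonoid.mem_centralizer_iff.mp r.2 z rfl))
  refine ⟨OreLocalization (Submonoid.powers z') (Submonoid.centralizer {z}), inferInstance,
    OreLocalization.numeratorHom, fun r hr => ?_, fun r s h => ?_⟩
  · obtain rfl : r = z' := Subtype.ext hr
    exact OreLocalization.numerator_isUnit (⟨z', 1, pow_one _⟩ : Submonoid.powers z')
  · rw [OreLocalization.numeratorHom_apply, OreLocalization.numeratorHom_apply,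
      OreLocalization.oreDiv_eq_iff] at h
    obtain ⟨⟨_, n, rfl⟩, v, h1, h2⟩ := h
    simp only [OneMemClass.coe_one, mul_one] at h2
    subst h2
    exact ⟨n, (congrArg Subtype.val h1).symm⟩

namespace Simple

/-- The simple element carried to position `n` when the product of `s` and the sequence `x` is
rewritten from left to right. -/
def carry (s : Simple) (x : ℕ → Simple) : ℕ → Simple
  | 0 => s
  | n + 1 => tail (carry s x n) (x n)

/-- Left multiplication by `s` on sequences of simple elements. -/
def act (s : Simple) : Function.End (ℕ → Simple) := fun x n => head (carry s x n) (x n)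

lemma act_mul {s t : Simple} (h : tail s t = 0) : act s * act t = act (head s t) := by
  funext x
  have key : ∀ n, tail (carry s (act t x) n) (carry t x n) = 0 ∧
      carry (head s t) x n = head (carry s (act t x) n) (carry t x n) := by
    intro n
    induction n with
    | zero => exact ⟨h, rfl⟩
    | succ n ih =>
      obtain ⟨h1, -, h3⟩ := head_tail_of_mul _ _ (x n) ih.1
      refine ⟨h1, ?_⟩
      change tail _ _ = _
      rw [ih.2, h3]
      rfl
  funext n
  change head (carry s (act t x) n) (head (carry t x n) (x n)) = head (carry (head s t) x n) (x n)
  rw [(key n).2, (head_tail_of_mul _ _ (x n) (key n).1).2.1]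

lemma act_mul_act_delta (s : Simple) : act s * act 13 = act 13 * act (conj s) := by
  obtain ⟨r, h1, h2, h3, h4⟩ := exists_mul_head s 13
  rw [head_delta_right] at h2
  have h5 : act r * act (conj s) = act 13 := (act_mul h3).trans (congrArg act h4)
  rw [← h5, ← mul_assoc, act_mul h1, h2, h5]

/-- A sequence of simple elements in left-weighted normal form. -/
def IsNormal (x : ℕ → Simple) : Prop :=
  ∀ n, head (x n) (x (n + 1)) = x n ∧ tail (x n) (x (n + 1)) = x (n + 1)

lemma isNormal_zero : IsNormal (fun _ => 0) := fun _ => ⟨head_zero_left 0, tail_zero_left 0⟩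

lemma IsNormal.act {x : ℕ → Simple} (hx : IsNormal x) (s : Simple) : IsNormal (act s x) :=
  fun n => normal_head_head (carry s x n) (x n) (x (n + 1)) (hx n).1 (hx n).2

lemma IsNormal.act_delta_succ {x : ℕ → Simple} (hx : IsNormal x) (n : ℕ) :
    Simple.act 13 x (n + 1) = x n := by
  have key : ∀ n, carry 13 x (n + 1) = x n := by
    intro n
    induction n with
    | zero => exact tail_delta _
    | succ n ih => rw [carry, ih]; exact (hx n).2
  change head (carry 13 x (n + 1)) (x (n + 1)) = x n
  rw [key]
  exact (hx n).1

lemma IsNormal.eq_of_act_delta_eq {x y : ℕ → Simple} (hx : IsNormal x) (hy : IsNormal y)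
    (h : Simple.act 13 x = Simple.act 13 y) : x = y := by
  funext n
  rw [← hx.act_delta_succ, h, hy.act_delta_succ]

lemma IsNormal.eq_of_act_delta_pow_eq {x y : ℕ → Simple} (hx : IsNormal x) (hy : IsNormal y)
    (n : ℕ) (h : (Simple.act 13 ^ n) x = (Simple.act 13 ^ n) y) : x = y := by
  induction n generalizing x y with
  | zero => exact h
  | succ n ih =>
    rw [pow_succ] at h
    exact hx.eq_of_act_delta_eq hy (ih (hx.act 13) (hy.act 13) h)

/-- The sequence representing the product of a word in the simple elements. -/
def normalForm (w : List Simple) : ℕ → Simple := (w.map act).prod fun _ => 0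

lemma normalForm_cons (s : Simple) (w : List Simple) :
    normalForm (s :: w) = act s (normalForm w) := rfl

lemma isNormal_normalForm (w : List Simple) : IsNormal (normalForm w) := by
  induction w with
  | nil => exact isNormal_zero
  | cons s w ih => exact ih.act s

lemma act_mem_centralizer (s : Simple) :
    act s ∈ Submonoid.centralizer {(act 13 ^ 4 : Function.End (ℕ → Simple))} := by
  rw [Submonoid.mem_centralizer_iff]
  rintro _ rfl
  symm
  have h : ∀ t, act t * act 13 = act 13 * act (conj t) := act_mul_act_delta
  calc act s * act 13 ^ 4 = act s * act 13 * act 13 * act 13 * act 13 := by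
        simp only [pow_succ, pow_zero, one_mul, mul_assoc]
    _ = act 13 * act 13 * act 13 * act 13 * act (conj (conj (conj (conj s)))) := by
        rw [h s, mul_assoc _ (act (conj s)), h (conj s), ← mul_assoc,
          mul_assoc _ (act (conj (conj s))), h (conj (conj s)), ← mul_assoc,
          mul_assoc _ (act (conj (conj (conj s)))), h (conj (conj (conj s))), ← mul_assoc]
    _ = _ := by
        rw [conj_conj_conj_conj]
        simp only [pow_succ, pow_zero, one_mul, mul_assoc]

lemma eval_eq_of_mul {G : Type*} [Group G] {u : Simple → G}
    (hu : ∀ s t, tail s t = 0 → u s * u t = u (head s t)) (s : Simple) :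
    eval (u 1) (u 2) (u 3) s = u s := by
  have h0 : u 0 = 1 := mul_eq_left.mp (hu 0 0 rfl)
  have h12 : u 1 * u 2 = u 7 := hu 1 2 rfl
  have h23 : u 2 * u 3 = u 8 := hu 2 3 rfl
  have h4 : u 1 * u 2 * (u 1)⁻¹ = u 4 := by rw [mul_inv_eq_iff_eq_mul, h12]; exact (hu 4 1 rfl).symm
  have h5 : u 2 * u 3 * (u 2)⁻¹ = u 5 := by rw [mul_inv_eq_iff_eq_mul, h23]; exact (hu 5 2 rfl).symm
  have h9 : u 1 * u 5 = u 9 := hu 1 5 rfl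
  have h6 : u 1 * u 5 * (u 1)⁻¹ = u 6 := by rw [mul_inv_eq_iff_eq_mul, h9]; exact (hu 6 1 rfl).symm
  fin_cases s
  · exact h0.symm
  · rfl
  · rfl
  · rfl
  · exact h4
  · exact h5
  · change u 1 * (u 2 * u 3 * (u 2)⁻¹) * (u 1)⁻¹ = u 6
    rw [h5, h6]
  · exact h12
  · exact h23
  · change u 1 * (u 2 * u 3 * (u 2)⁻¹) = u 9
    rw [h5, h9]
  · change u 1 * u 2 * (u 1)⁻¹ * u 3 = u 10
    rw [h4]; exact hu 4 3 rfl
  · exact hu 1 3 rfl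
  · change u 2 * (u 1 * (u 2 * u 3 * (u 2)⁻¹) * (u 1)⁻¹) = u 12
    rw [h5, h6]; exact hu 2 6 rfl
  · change u 1 * u 2 * u 3 = u 13
    rw [h12]; exact hu 7 3 rfl

lemma map_eval {G H : Type*} [Group G] [Group H] (φ : G →* H) (a b c : G) (s : Simple) :
    φ (eval a b c s) = eval (φ a) (φ b) (φ c) s := by
  fin_cases s <;> simp [eval]

end Simple

lemma braid_relations : a * b * a = b * a * b ∧ b * c * b = c * b * c ∧ a * c = c * a := by
  have h : ∀ r ∈ braidRels4, PresentedGroup.mk braidRels4 r = 1 := fun r hr =>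
    PresentedGroup.one_of_mem hr
  refine ⟨?_, ?_, ?_⟩
  · have := h _ (Or.inl rfl)
    rw [map_mul, map_inv, mul_inv_eq_one] at this
    simp only [map_mul] at this
    exact this
  · have := h _ (Or.inr (Or.inl rfl))
    rw [map_mul, map_inv, mul_inv_eq_one] at this
    simp only [map_mul] at this
    exact this
  · have := h _ (Or.inr (Or.inr rfl))
    rw [map_mul, map_inv, mul_inv_eq_one] at this
    simp only [map_mul] at this
    exact this

lemma B4.exists_hom {H : Type*} [Group H] {x y z : H} (h₁ : x * y * x = y * x * y)
    (h₂ : y * z * y = z * y * z) (h₃ : x * z = z * x) :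
    ∃ φ : B4 →* H, φ a = x ∧ φ b = y ∧ φ c = z := by
  have h : ∀ r ∈ braidRels4, FreeGroup.lift ![x, y, z] r = 1 := by
    rintro _ (rfl | rfl | rfl) <;>
      simp only [map_mul, map_inv, FreeGroup.lift_apply_of, mul_inv_eq_one]
    · exact h₁
    · exact h₂
    · exact h₃
  exact ⟨PresentedGroup.toGroup h, PresentedGroup.toGroup.of h, PresentedGroup.toGroup.of h,
    PresentedGroup.toGroup.of h⟩

namespace B4

/-- The simple elements of `B₄`. -/
def simple (s : Simple) : B4 := s.eval a b c

lemma simple_mul {s t : Simple} (h : s.tail t = 0) : simple s * simple t = simple (s.head t) :=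
  Simple.eval_mul braid_relations.1 braid_relations.2.1 braid_relations.2.2 h

/-- The normal form of a positive element of `B₄` does not depend on the word representing it. -/
lemma normalForm_eq {w w' : List Simple} (h : (w.map simple).prod = (w'.map simple).prod) :
    Simple.normalForm w = Simple.normalForm w' := by
  obtain ⟨H, _, φ, hz, hφ⟩ := exists_localization_centralizer
    (Simple.act 13 ^ 4 : Function.End (ℕ → Simple))
  let α : Simple → Submonoid.centralizer {(Simple.act 13 ^ 4 : Function.End (ℕ → Simple))} :=
    fun s => ⟨s.act, s.act_mem_centralizer⟩
  have hα : ∀ s t, s.tail t = 0 → α s * α t = α (s.head t) := fun s t h =>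
    Subtype.ext (Simple.act_mul h)
  have hδ : IsUnit (φ (α 13)) := by
    have := hz (α 13 ^ 4) rfl
    rw [map_pow] at this
    exact (isUnit_pow_iff (by norm_num)).mp this
  have hunit : ∀ s, IsUnit (φ (α s)) := by
    intro s
    obtain ⟨r, h1, h2, -⟩ := Simple.exists_mul_head s 13
    obtain ⟨l, h3, h4⟩ := Simple.exists_left_compl s
    rw [Simple.head_delta_right] at h2
    have e1 : φ (α s) * φ (α r) = φ (α 13) := by rw [← map_mul, hα _ _ h1, h2]
    have e2 : φ (α l) * φ (α s) = φ (α 13) := by rw [← map_mul, hα _ _ h3, h4]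
    obtain ⟨d, hd⟩ := hδ
    refine isUnit_iff_exists_and_exists.mpr ⟨⟨φ (α r) * ↑d⁻¹, ?_⟩, ⟨↑d⁻¹ * φ (α l), ?_⟩⟩
    · rw [← mul_assoc, e1, ← hd, Units.mul_inv]
    · rw [mul_assoc, e2, ← hd, Units.inv_mul]
  choose u hu using hunit
  have humul : ∀ s t, s.tail t = 0 → u s * u t = u (s.head t) := fun s t h => by
    ext
    rw [Units.val_mul, hu, hu, hu, ← map_mul, hα _ _ h]
  have h12 : u 1 * u 2 = u 7 := humul 1 2 rfl
  have h24 : u 2 * u 4 = u 7 := humul 2 4 rfl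
  have h41 : u 4 * u 1 = u 7 := humul 4 1 rfl
  have h23 : u 2 * u 3 = u 8 := humul 2 3 rfl
  have h35 : u 3 * u 5 = u 8 := humul 3 5 rfl
  have h52 : u 5 * u 2 = u 8 := humul 5 2 rfl
  have h13 : u 1 * u 3 = u 11 := humul 1 3 rfl
  have h31 : u 3 * u 1 = u 11 := humul 3 1 rfl
  obtain ⟨Φ, ha, hb, hc⟩ := exists_hom (x := u 1) (y := u 2) (z := u 3)
    (by rw [h12, ← h24, mul_assoc, h41, mul_assoc, h12])
    (by rw [h23, ← h35, mul_assoc, h52, mul_assoc, h23])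
    (h13.trans h31.symm)
  have hΦ : ∀ s, Φ (simple s) = u s := fun s => by
    rw [simple, Simple.map_eval, ha, hb, hc, Simple.eval_eq_of_mul humul]
  have hword : ∀ w : List Simple, ((Φ (w.map simple).prod : Hˣ) : H) = φ (w.map α).prod := by
    intro w
    induction w with
    | nil => simp
    | cons s w ih => simp [hΦ, hu, ih]
  obtain ⟨n, hn⟩ := hφ _ _ ((hword w).symm.trans ((congrArg _ (congrArg Φ h)).trans (hword w')))
  have hval : ∀ w : List Simple, ((w.map α).prod : Function.End (ℕ → Simple)) =
      (w.map Simple.act).prod := by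
    intro w
    induction w with
    | nil => rfl
    | cons s w ih => rw [List.map_cons, List.prod_cons, Submonoid.coe_mul, ih]; rfl
  rw [hval, hval, ← pow_mul] at hn
  exact (Simple.isNormal_normalForm w).eq_of_act_delta_pow_eq (Simple.isNormal_normalForm w') _
    (congrFun hn fun _ => 0)

end B4

namespace B4

open Simple

lemma simple_zero : simple 0 = 1 := rfl

lemma simple_mul_simple (s x : Simple) :
    simple s * simple x = simple (head s x) * simple (tail s x) := by
  obtain ⟨r, h1, h2, h3, h4⟩ := exists_mul_head s x
  rw [← h2, ← simple_mul h1, mul_assoc, simple_mul h3, h4]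

/-- The dual positive monoid of `B₄`. -/
def positive : Submonoid B4 := Submonoid.closure (Set.range simple)

lemma simple_mem_positive (s : Simple) : simple s ∈ positive :=
  Submonoid.subset_closure ⟨s, rfl⟩

lemma prod_mem_positive (w : List Simple) : (w.map simple).prod ∈ positive :=
  Submonoid.list_prod_mem _ fun _ hx => by
    obtain ⟨s, -, rfl⟩ := List.mem_map.mp hx
    exact simple_mem_positive s

lemma exists_word {g : B4} (hg : g ∈ positive) : ∃ w : List Simple, (w.map simple).prod = g := by
  induction hg using Submonoid.closure_induction with
  | mem x hx => obtain ⟨s, rfl⟩ := hx; exact ⟨[s], by simp⟩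
  | one => exact ⟨[], rfl⟩
  | mul x y _ _ hx hy =>
    obtain ⟨w, rfl⟩ := hx
    obtain ⟨w', rfl⟩ := hy
    exact ⟨w ++ w', by simp⟩

lemma simple_mul_prod (s : Simple) (y : ℕ → Simple) (n : ℕ) :
    simple s * ((List.range n).map fun i => simple (y i)).prod =
      ((List.range n).map fun i => simple (act s y i)).prod * simple (carry s y n) := by
  induction n with
  | zero => simp [carry]
  | succ n ih =>
    rw [List.prod_range_succ, List.prod_range_succ, ← mul_assoc, ih, mul_assoc,
      simple_mul_simple, ← mul_assoc]
    rfl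

lemma exists_prod_normalForm (w : List Simple) : ∃ N, (∀ n ≥ N, normalForm w n = 0) ∧
    ((List.range N).map fun i => simple (normalForm w i)).prod = (w.map simple).prod := by
  induction w with
  | nil => exact ⟨0, fun _ _ => rfl, rfl⟩
  | cons s w ih =>
    obtain ⟨N, h0, h⟩ := ih
    have hc : ∀ n ≥ N + 1, carry s (normalForm w) n = 0 := by
      rintro (_ | n) hn
      · omega
      · rw [carry, h0 n (by omega), tail_zero_right]
    refine ⟨N + 1, fun n hn => ?_, ?_⟩
    · change head (carry s (normalForm w) n) (normalForm w n) = 0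
      rw [hc n hn, h0 n (by omega), head_zero_left]
    · have := simple_mul_prod s (normalForm w) (N + 1)
      rw [hc _ le_rfl, simple_zero, mul_one] at this
      rw [normalForm_cons, ← this, List.prod_range_succ, h, h0 N le_rfl, simple_zero, mul_one,
        List.map_cons, List.prod_cons]

/-- Left divisibility in `B₄` with respect to the dual positive monoid. -/
def LeftDvd (g h : B4) : Prop := g⁻¹ * h ∈ positive

lemma LeftDvd.trans {g h k : B4} (h₁ : LeftDvd g h) (h₂ : LeftDvd h k) : LeftDvd g k := by
  have := mul_mem h₁ h₂
  rwa [mul_assoc, mul_inv_cancel_left] at this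

lemma leftDvd_refl (g : B4) : LeftDvd g g := by
  rw [LeftDvd, inv_mul_cancel]; exact one_mem _

lemma leftDvd_mul_right (g : B4) {h : B4} (hh : h ∈ positive) : LeftDvd g (g * h) := by
  rwa [LeftDvd, inv_mul_cancel_left]

lemma one_leftDvd {g : B4} : LeftDvd 1 g ↔ g ∈ positive := by
  rw [LeftDvd, inv_one, one_mul]

lemma mul_leftDvd (k g h : B4) : LeftDvd (k * g) h ↔ LeftDvd g (k⁻¹ * h) := by
  rw [LeftDvd, LeftDvd, mul_inv_rev, mul_assoc]

lemma leftDvd_mul (k g h : B4) : LeftDvd g (k * h) ↔ LeftDvd (k⁻¹ * g) h := by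
  rw [LeftDvd, LeftDvd, mul_inv_rev, inv_inv, mul_assoc]

lemma leftDvd_simple {s t : Simple} (h : Dvd s t) : LeftDvd (simple s) (simple t) := by
  obtain ⟨r, h1, rfl⟩ := h
  rw [← simple_mul h1]
  exact leftDvd_mul_right _ (simple_mem_positive r)

/-- Every positive element has a greatest simple left divisor. -/
lemma exists_head {g : B4} (hg : g ∈ positive) : ∃ h, LeftDvd (simple h) g ∧
    ∀ s, LeftDvd (simple s) g → Dvd s h := by
  obtain ⟨w, rfl⟩ := exists_word hg
  refine ⟨normalForm w 0, ?_, fun s hs => ?_⟩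
  · obtain ⟨N, h0, h⟩ := exists_prod_normalForm w
    have h' : ((List.range (N + 1)).map fun i => simple (normalForm w i)).prod =
        (w.map simple).prod := by
      rw [List.prod_range_succ, h, h0 N le_rfl, simple_zero, mul_one]
    rw [← h', List.prod_range_succ']
    refine leftDvd_mul_right _ (Submonoid.list_prod_mem _ fun _ hx => ?_)
    obtain ⟨i, -, rfl⟩ := List.mem_map.mp hx
    exact simple_mem_positive _
  · obtain ⟨w', hw'⟩ := exists_word hs
    have : ((s :: w').map simple).prod = (w.map simple).prod := by
      rw [List.map_cons, List.prod_cons, hw', mul_inv_cancel_left]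
    rw [← normalForm_eq this, normalForm_cons]
    obtain ⟨r, h1, h2, -⟩ := exists_mul_head s (normalForm w' 0)
    exact ⟨r, h1, h2⟩

lemma exists_simple_lcm (s t : Simple) : ∃ u, LeftDvd (simple s) (simple u) ∧
    LeftDvd (simple t) (simple u) ∧
    ∀ g ∈ positive, LeftDvd (simple s) g → LeftDvd (simple t) g → LeftDvd (simple u) g := by
  obtain ⟨u, hs, ht, hu⟩ := exists_lcm s t
  refine ⟨u, leftDvd_simple hs, leftDvd_simple ht, fun g hg h₁ h₂ => ?_⟩
  obtain ⟨h, hh, hmax⟩ := exists_head hg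
  exact (leftDvd_simple (hu h (hmax s h₁) (hmax t h₂))).trans hh

lemma eq_one_or_exists_leftDvd {g : B4} (hg : g ∈ positive) :
    g = 1 ∨ ∃ s ≠ 0, LeftDvd (simple s) g := by
  obtain ⟨w, rfl⟩ := exists_word hg
  induction w with
  | nil => exact Or.inl rfl
  | cons s w ih =>
    rw [List.map_cons, List.prod_cons]
    by_cases hs : s = 0
    · subst hs
      rw [simple_zero, one_mul]
      exact ih (prod_mem_positive w)
    · exact Or.inr ⟨s, hs, leftDvd_mul_right _ (prod_mem_positive w)⟩

lemma exists_degree : ∃ φ : B4 →* Multiplicative ℤ, φ a = Multiplicative.ofAdd 1 ∧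
    φ b = Multiplicative.ofAdd 1 ∧ φ c = Multiplicative.ofAdd 1 :=
  exists_hom rfl rfl rfl

/-- The exponent sum of a braid. -/
noncomputable def degree (g : B4) : ℤ := (exists_degree.choose g).toAdd

lemma degree_mul (g h : B4) : degree (g * h) = degree g + degree h := by
  rw [degree, map_mul, toAdd_mul]; rfl

lemma degree_one : degree 1 = 0 := by
  rw [degree, map_one, toAdd_one]

lemma degree_inv_mul (g h : B4) : degree (g⁻¹ * h) = degree h - degree g := by
  have := degree_mul g (g⁻¹ * h)
  rw [mul_inv_cancel_left] at this
  omega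

lemma degree_simple (s : Simple) :
    degree (simple s) = ![0, 1, 1, 1, 1, 1, 1, 2, 2, 2, 2, 2, 2, 3] s := by
  obtain ⟨ha, hb, hc⟩ := exists_degree.choose_spec
  rw [degree, simple, map_eval, ha, hb, hc]
  revert s
  decide

lemma one_le_degree_simple {s : Simple} (hs : s ≠ 0) : 1 ≤ degree (simple s) := by
  rw [degree_simple]
  revert s
  decide

lemma eq_one_or_one_le_degree {g : B4} (hg : g ∈ positive) : g = 1 ∨ 1 ≤ degree g := by
  obtain ⟨w, rfl⟩ := exists_word hg
  induction w with
  | nil => exact Or.inl rfl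
  | cons s w ih =>
    rw [List.map_cons, List.prod_cons]
    by_cases hs : s = 0
    · subst hs
      rw [simple_zero, one_mul]
      exact ih (prod_mem_positive w)
    · right
      rw [degree_mul]
      have := one_le_degree_simple hs
      rcases ih (prod_mem_positive w) with h | h
      · rw [h, degree_one]; omega
      · omega

lemma degree_nonneg {g : B4} (hg : g ∈ positive) : 0 ≤ degree g := by
  rcases eq_one_or_one_le_degree hg with rfl | h
  · exact degree_one.ge
  · omega

/-- Positive elements have greatest common left divisors. -/
lemma exists_gcd (n : ℕ) : ∀ g ∈ positive, ∀ h ∈ positive, degree g < n →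
    ∃ z ∈ positive, LeftDvd z g ∧ LeftDvd z h ∧
      ∀ u ∈ positive, LeftDvd u g → LeftDvd u h → LeftDvd u z := by
  induction n with
  | zero =>
    intro g hg h hh hn
    have := degree_nonneg hg
    push_cast at hn
    omega
  | succ n ih =>
    intro g hg h hh hn
    push_cast at hn
    by_cases hs : ∃ s ≠ 0, LeftDvd (simple s) g ∧ LeftDvd (simple s) h
    · obtain ⟨s, hs, hsg, hsh⟩ := hs
      have key : ∀ t ≠ 0, LeftDvd (simple t) g → LeftDvd (simple t) h → _ :=
        fun t ht htg hth => ih _ htg _ hth (by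
          rw [degree_inv_mul]; have := one_le_degree_simple ht; omega)
      obtain ⟨z, hz, hzg, hzh, hmax⟩ := key s hs hsg hsh
      have hz' := mul_mem (simple_mem_positive s) hz
      refine ⟨simple s * z, hz', (mul_leftDvd _ _ _).mpr hzg, (mul_leftDvd _ _ _).mpr hzh,
        fun u hu hug huh => ?_⟩
      rcases eq_one_or_exists_leftDvd hu with rfl | ⟨t, ht, htu⟩
      · exact one_leftDvd.mpr hz'
      obtain ⟨y, hy, hyg, hyh, hymax⟩ := key t ht (htu.trans hug) (htu.trans huh)
      have dvd_of : ∀ v, LeftDvd (simple t) v → LeftDvd v g → LeftDvd v h →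
          LeftDvd v (simple t * y) := fun v htv hvg hvh => by
        rw [leftDvd_mul]
        exact hymax _ htv (by rwa [← mul_leftDvd, mul_inv_cancel_left])
          (by rwa [← mul_leftDvd, mul_inv_cancel_left])
      obtain ⟨r, hsr, htr, hr⟩ := exists_simple_lcm s t
      have hry := dvd_of _ htr (hr g hg hsg (htu.trans hug)) (hr h hh hsh (htu.trans huh))
      have hyz : LeftDvd ((simple s)⁻¹ * (simple t * y)) z := by
        refine hmax _ (hsr.trans hry) ?_ ?_
        · rw [← mul_leftDvd, mul_inv_cancel_left]
          exact (mul_leftDvd _ _ _).mpr hyg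
        · rw [← mul_leftDvd, mul_inv_cancel_left]
          exact (mul_leftDvd _ _ _).mpr hyh
      exact (dvd_of u htu hug huh).trans ((leftDvd_mul _ _ _).mpr hyz)
    · refine ⟨1, one_mem _, one_leftDvd.mpr hg, one_leftDvd.mpr hh, fun u hu hug huh => ?_⟩
      rcases eq_one_or_exists_leftDvd hu with rfl | ⟨t, ht, htu⟩
      · exact leftDvd_refl 1
      · exact absurd ⟨t, ht, htu.trans hug, htu.trans huh⟩ hs

/-- The dual Garside element of `B₄`. -/
def delta : B4 := simple 13

lemma delta_mem : delta ∈ positive := simple_mem_positive 13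

lemma simple_mul_delta (s : Simple) : simple s * delta = delta * simple (conj s) := by
  obtain ⟨r, h1, h2, h3, h4⟩ := exists_mul_head s 13
  rw [head_delta_right] at h2
  have h5 : simple r * simple (conj s) = delta := (simple_mul h3).trans (congrArg simple h4)
  rw [← h5, ← mul_assoc, simple_mul h1, h2, h5]
  rfl

lemma map_mem_positive {φ : B4 →* B4} (h : ∀ s, φ (simple s) ∈ positive) {g : B4}
    (hg : g ∈ positive) : φ g ∈ positive := by
  have : positive ≤ positive.comap φ := (Submonoid.closure_le).mpr (by
    rintro _ ⟨s, rfl⟩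
    exact h s)
  exact this hg

lemma conj_mem {g : B4} (hg : g ∈ positive) : delta * g * delta⁻¹ ∈ positive := by
  refine map_mem_positive (φ := (MulAut.conj delta).toMonoidHom) (fun s => ?_) hg
  have : delta * simple s * delta⁻¹ = simple (conj (conj (conj s))) := by
    rw [mul_inv_eq_iff_eq_mul, simple_mul_delta, conj_conj_conj_conj]
  change delta * simple s * delta⁻¹ ∈ positive
  rw [this]
  exact simple_mem_positive _

lemma conj_mem' {g : B4} (hg : g ∈ positive) : delta⁻¹ * g * delta ∈ positive := by
  refine map_mem_positive (φ := (MulAut.conj delta⁻¹).toMonoidHom) (fun s => ?_) hg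
  have : delta⁻¹ * simple s * delta = simple (conj s) := by
    rw [mul_assoc, simple_mul_delta, inv_mul_cancel_left]
  change delta⁻¹ * simple s * delta⁻¹⁻¹ ∈ positive
  rw [inv_inv, this]
  exact simple_mem_positive _

lemma conj_pow_mem (n : ℕ) {g : B4} (hg : g ∈ positive) :
    (delta ^ n)⁻¹ * g * delta ^ n ∈ positive := by
  induction n with
  | zero => simpa
  | succ n ih =>
    have := conj_mem' ih
    simpa [pow_succ, mul_assoc] using this

lemma conj_pow_mem' (n : ℕ) {g : B4} (hg : g ∈ positive) :
    delta ^ n * g * (delta ^ n)⁻¹ ∈ positive := by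
  induction n with
  | zero => simpa
  | succ n ih =>
    have := conj_mem ih
    simpa [pow_succ', mul_assoc] using this

lemma exists_mul_delta_pow_mem (g : B4) : ∃ n : ℕ, g * delta ^ n ∈ positive := by
  have hgen : ∀ s, ∃ n : ℕ, (simple s)⁻¹ * delta ^ n ∈ positive := fun s => by
    obtain ⟨r, h1, h2, -⟩ := exists_mul_head s 13
    rw [head_delta_right] at h2
    refine ⟨1, ?_⟩
    rw [pow_one, delta, ← h2, ← simple_mul h1, inv_mul_cancel_left]
    exact simple_mem_positive r
  have htop : Subgroup.closure (Set.range (PresentedGroup.of (rels := braidRels4))) = ⊤ :=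
    PresentedGroup.closure_range_of _
  have hof : ∀ i : Fin 3, ∃ s, PresentedGroup.of (rels := braidRels4) i = simple s := by
    intro i
    fin_cases i
    · exact ⟨1, rfl⟩
    · exact ⟨2, rfl⟩
    · exact ⟨3, rfl⟩
  have hg : g ∈ Subgroup.closure (Set.range (PresentedGroup.of (rels := braidRels4))) := by
    rw [htop]; trivial
  induction hg using Subgroup.closure_induction'' with
  | mem x hx =>
    obtain ⟨i, rfl⟩ := hx
    obtain ⟨s, hs⟩ := hof i
    exact ⟨0, by rw [hs, pow_zero, mul_one]; exact simple_mem_positive s⟩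
  | inv_mem x hx =>
    obtain ⟨i, rfl⟩ := hx
    obtain ⟨s, hs⟩ := hof i
    rw [hs]
    exact hgen s
  | one => exact ⟨0, by simp⟩
  | mul x y _ _ hx hy =>
    obtain ⟨m, hm⟩ := hx
    obtain ⟨n, hn⟩ := hy
    refine ⟨n + m, ?_⟩
    have := mul_mem hm (conj_pow_mem m hn)
    simpa [pow_add, mul_assoc] using this

lemma interpolation (x₁ x₂ y₁ y₂ : B4) (h₁₁ : LeftDvd x₁ y₁) (h₁₂ : LeftDvd x₁ y₂)
    (h₂₁ : LeftDvd x₂ y₁) (h₂₂ : LeftDvd x₂ y₂) :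
    ∃ z, LeftDvd x₁ z ∧ LeftDvd x₂ z ∧ LeftDvd z y₁ ∧ LeftDvd z y₂ := by
  obtain ⟨N, hN⟩ := exists_mul_delta_pow_mem (x₂⁻¹ * x₁)
  obtain ⟨w, hw⟩ : ∃ w, w = x₂ * (delta ^ N)⁻¹ := ⟨_, rfl⟩
  have hwx₂ : LeftDvd w x₂ := by
    rw [LeftDvd, hw, mul_inv_rev, inv_inv, mul_assoc, inv_mul_cancel, mul_one]
    exact pow_mem delta_mem N
  have hwx₁ : LeftDvd w x₁ := by
    have := conj_pow_mem' N hN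
    rw [← mul_assoc, mul_inv_cancel_right] at this
    rwa [LeftDvd, hw, mul_inv_rev, inv_inv, mul_assoc]
  obtain ⟨n, hn⟩ : ∃ n : ℕ, degree (w⁻¹ * y₁) < n :=
    ⟨(degree (w⁻¹ * y₁)).toNat + 1, by push_cast; exact Int.lt_add_one_of_le (Int.self_le_toNat _)⟩
  obtain ⟨z, -, hz₁, hz₂, hz⟩ :=
    exists_gcd n _ (hwx₁.trans h₁₁) _ (hwx₁.trans h₁₂) hn
  have hle : ∀ x, LeftDvd w x → LeftDvd x y₁ → LeftDvd x y₂ → LeftDvd x (w * z) := fun x h h₁ h₂ =>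
    (leftDvd_mul _ _ _).mpr <| hz _ h (by rwa [← mul_leftDvd, mul_inv_cancel_left])
      (by rwa [← mul_leftDvd, mul_inv_cancel_left])
  exact ⟨w * z, hle _ hwx₁ h₁₁ h₁₂, hle _ hwx₂ h₂₁ h₂₂, (mul_leftDvd _ _ _).mpr hz₁,
    (mul_leftDvd _ _ _).mpr hz₂⟩

/-- The dual Garside structure of `B₄`. -/
noncomputable def garsideOrder : GarsideOrder B4 where
  pos := positive
  deg := degree
  δ := delta
  deg_mul := degree_mul
  deg_δ := degree_simple 13
  δ_mem := delta_mem
  deg_nonneg _ := degree_nonneg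
  eq_one g hg h := (eq_one_or_one_le_degree hg).resolve_right (by omega)
  conj_mem _ := conj_mem
  conj_mem' _ := conj_mem'
  bounded g := by
    obtain ⟨n, hn⟩ := exists_mul_delta_pow_mem g
    exact ⟨n, by rwa [zpow_natCast]⟩
  interp := interpolation

end B4

/-- The braid group `B₄` has the ℓ² spectral radius property: for every finitely
supported `a : B₄ → ℂ`, if `T = L_a` is the bounded operator on `ℓ²(B₄)` of left
convolution by `a`, then the spectral radius of `T` equals
`lim_{n→∞} ‖a^{*n}‖₂^{1/n}`. -/
theorem B4_l2_spectral_radius_property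
    (f : B4 →₀ ℂ)
    (T : lp (fun _ : B4 => ℂ) 2 →L[ℂ] lp (fun _ : B4 => ℂ) 2)
    (hT : ∀ (ξ : lp (fun _ : B4 => ℂ) 2) (g : B4),
       T ξ g = f.sum fun h ch => ch * ξ (h⁻¹ * g)) :
    Filter.Tendsto (fun n : ℕ => l2norm (convPow f n) ^ (1 / (n : ℝ)))
      Filter.atTop (nhds (spectralRadius ℂ T).toReal) := by
  exact B4.garsideOrder.tendsto_l2norm_convPow hT
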